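/- arXiv:2409.17098 — 4 statements merged into one kernel-verified Lean document; each statement's English description precedes it below -/
import Mathlib

section
/- For any point placement P of n points, the sum over all 3-element subsets T of P of the binomial coefficient C(γ_T, 2) equals 10·P₅(P) + 3·U(P). -/
open Finset

/-- A finite set of points in the plane is in *general position* if no three of
its points are collinear. -/
def GenPos (P : Finset (ℝ × ℝ)) : Prop :=
  ∀ x ∈ P, ∀ y ∈ P, ∀ z ∈ P, x ≠ y → x ≠ z → y ≠ z →
    ¬ Collinear ℝ ({x, y, z} : Set (ℝ × ℝ))

/-- A finite set of points is in *convex position* if every point of it is an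
extreme point of its convex hull. -/
def ConvexPos (S : Finset (ℝ × ℝ)) : Prop :=
  ∀ x ∈ S, x ∈ Set.extremePoints ℝ (convexHull ℝ (S : Set (ℝ × ℝ)))

open scoped Classical in
/-- Number of `k`-element subsets of `P` that are in convex position. -/
noncomputable def convexPosCount (P : Finset (ℝ × ℝ)) (k : ℕ) : ℕ :=
  ((P.powersetCard k).filter fun S => ConvexPos S).card

/-- `mu k n` is the minimum number of `k`-element subsets in convex position over
all placements of `n` points in general position. -/
noncomputable def mu (k n : ℕ) : ℕ :=
  sInf {m | ∃ P : Finset (ℝ × ℝ), GenPos P ∧ P.card = n ∧ convexPosCount P k = m}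

/-- `x` is a γ-point of `T` if `T ∪ {x}` is in convex position. -/
def IsGammaPt (T : Finset (ℝ × ℝ)) (x : ℝ × ℝ) : Prop :=
  ConvexPos (insert x T)

/-- `x` is a β-point of `T` if `T ∪ {x}` is not in convex position and `x` does not
lie in the convex hull of `T`. -/
def IsBetaPt (T : Finset (ℝ × ℝ)) (x : ℝ × ℝ) : Prop :=
  ¬ ConvexPos (insert x T) ∧ x ∉ convexHull ℝ (T : Set (ℝ × ℝ))

open scoped Classical in
/-- `γ_T`: number of γ-points of `T` among the points of `P \ T`. -/
noncomputable def gammaCount (P T : Finset (ℝ × ℝ)) : ℕ :=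
  ((P \ T).filter fun x => IsGammaPt T x).card

open scoped Classical in
/-- `β_T`: number of β-points of `T` among the points of `P \ T`. -/
noncomputable def betaCount (P T : Finset (ℝ × ℝ)) : ℕ :=
  ((P \ T).filter fun x => IsBetaPt T x).card

open scoped Classical in
/-- Number of `k`-element subsets of `P` whose convex hull has exactly `j`
extreme points. -/
noncomputable def hullCount (P : Finset (ℝ × ℝ)) (k j : ℕ) : ℕ :=
  ((P.powersetCard k).filter fun S =>
    (Set.extremePoints ℝ (convexHull ℝ (S : Set (ℝ × ℝ)))).ncard = j).card

/-- `x` and `y` lie strictly on the same side of the line through `p` and `q`. -/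
def SameSide (p q x y : ℝ × ℝ) : Prop :=
  0 < ((q.1 - p.1) * (x.2 - p.2) - (q.2 - p.2) * (x.1 - p.1)) *
      ((q.1 - p.1) * (y.2 - p.2) - (q.2 - p.2) * (y.1 - p.1))

/-- `x` and `y` lie in the same region with respect to `T`: for each pair of
distinct points of `T`, they lie strictly on the same side of the line through them. -/
def SameRegion (T : Finset (ℝ × ℝ)) (x y : ℝ × ℝ) : Prop :=
  ∀ p ∈ T, ∀ q ∈ T, p ≠ q → SameSide p q x y

open scoped Classical in
/-- Number of 2-element subsets `{x, y}` of `P \ T` such that `x` and `y` are both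
γ-points of `T` lying in the same region with respect to `T`. -/
noncomputable def gammaSamePairs (P T : Finset (ℝ × ℝ)) : ℕ :=
  (((P \ T).powersetCard 2).filter fun S =>
    (∀ x ∈ S, IsGammaPt T x) ∧ ∀ x ∈ S, ∀ y ∈ S, x ≠ y → SameRegion T x y).card

open scoped Classical in
/-- Number of 2-element subsets `{x, y}` of `P \ T` such that `x` and `y` are both
γ-points of `T` lying in distinct regions with respect to `T`. -/
noncomputable def gammaDiffPairs (P T : Finset (ℝ × ℝ)) : ℕ :=
  (((P \ T).powersetCard 2).filter fun S =>
    (∀ x ∈ S, IsGammaPt T x) ∧ ∀ x ∈ S, ∀ y ∈ S, x ≠ y → ¬ SameRegion T x y).card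

open scoped Classical in
/-- Number of 2-element subsets `{x, y}` of `P \ T` such that `x` and `y` are both
β-points of `T` lying in the same region with respect to `T`. -/
noncomputable def betaSamePairs (P T : Finset (ℝ × ℝ)) : ℕ :=
  (((P \ T).powersetCard 2).filter fun S =>
    (∀ x ∈ S, IsBetaPt T x) ∧ ∀ x ∈ S, ∀ y ∈ S, x ≠ y → SameRegion T x y).card

open scoped Classical in
/-- Number of 2-element subsets `{x, y}` of `P \ T` such that `x` and `y` are both
β-points of `T` lying in distinct regions with respect to `T`. -/
noncomputable def betaDiffPairs (P T : Finset (ℝ × ℝ)) : ℕ :=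
  (((P \ T).powersetCard 2).filter fun S =>
    (∀ x ∈ S, IsBetaPt T x) ∧ ∀ x ∈ S, ∀ y ∈ S, x ≠ y → ¬ SameRegion T x y).card

theorem GenPos.mono {P Q : Finset (ℝ × ℝ)} (hP : GenPos P) (h : Q ⊆ P) : GenPos Q :=
  fun x hx y hy z hz => hP x (h hx) y (h hy) z (h hz)

/-- A point of a finite set is extreme in the convex hull exactly when it is not in the convex hull
of the other points. -/
theorem mem_extremePoints_convexHull_iff_notMem_erase {Q : Finset (ℝ × ℝ)} {x : ℝ × ℝ}
    (hx : x ∈ Q) :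
    x ∈ Set.extremePoints ℝ (convexHull ℝ (Q : Set (ℝ × ℝ))) ↔
      x ∉ convexHull ℝ (Q.erase x : Set (ℝ × ℝ)) := by
  constructor
  · intro h hx'
    rw [(convex_convexHull ℝ _).mem_extremePoints_iff_mem_sdiff_convexHull_sdiff] at h
    refine h.2 (convexHull_mono ?_ hx')
    intro y hy
    rw [mem_coe, mem_erase] at hy
    exact ⟨subset_convexHull ℝ _ hy.2, hy.1⟩
  · intro h
    by_contra hne
    have hsub : Set.extremePoints ℝ (convexHull ℝ (Q : Set (ℝ × ℝ))) ⊆ Q.erase x := by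
      intro y hy
      rw [mem_coe, mem_erase]
      exact ⟨fun hyx => hne (hyx ▸ hy), extremePoints_convexHull_subset hy⟩
    have hKM := closure_convexHull_extremePoints (Q.finite_toSet.isCompact_convexHull ℝ)
      (convex_convexHull ℝ (Q : Set (ℝ × ℝ)))
    have hmem : x ∈ closure (convexHull ℝ (Q.erase x : Set (ℝ × ℝ))) :=
      closure_mono (convexHull_mono hsub) (hKM.symm ▸ subset_convexHull ℝ _ hx)
    rw [((Q.erase x).finite_toSet.isClosed_convexHull ℝ).closure_eq] at hmem
    exact h hmem

open scoped Classical in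
/-- Of four points in general position, at most one lies in the triangle of the other three. -/
theorem card_filter_mem_convexHull_erase_le_one {F : Finset (ℝ × ℝ)} (hF : GenPos F)
    (hcard : F.card = 4) :
    (F.filter fun p => p ∈ convexHull ℝ (F.erase p : Set (ℝ × ℝ))).card ≤ 1 := by
  rw [card_le_one]
  intro p hp q hq
  rw [mem_filter] at hp hq
  by_contra hpq
  obtain ⟨r, s, hrs, hF'⟩ : ∃ r s, r ≠ s ∧ (F.erase p).erase q = {r, s} := by
    rw [← card_eq_two, card_erase_of_mem (mem_erase.2 ⟨Ne.symm hpq, hq.1⟩),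
      card_erase_of_mem hp.1, hcard]
  have hr : r ∈ (F.erase p).erase q := by simp [hF']
  have hs : s ∈ (F.erase p).erase q := by simp [hF']
  simp only [mem_erase] at hr hs
  have hsub : Set.extremePoints ℝ (convexHull ℝ (F : Set (ℝ × ℝ))) ⊆ {r, s} := by
    intro y hy
    have hyF : y ∈ F := extremePoints_convexHull_subset hy
    have hy' := (mem_extremePoints_convexHull_iff_notMem_erase hyF).1 hy
    have : y ∈ (F.erase p).erase q := by
      simp only [mem_erase]
      exact ⟨fun h => hy' (h ▸ hq.2), fun h => hy' (h ▸ hp.2), hyF⟩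
    simpa [hF'] using this
  have hKM := closure_convexHull_extremePoints (F.finite_toSet.isCompact_convexHull ℝ)
    (convex_convexHull ℝ (F : Set (ℝ × ℝ)))
  have hmem : p ∈ closure (convexHull ℝ ({r, s} : Set (ℝ × ℝ))) :=
    closure_mono (convexHull_mono hsub) (hKM.symm ▸ subset_convexHull ℝ _ hp.1)
  rw [((Set.toFinite {r, s}).isClosed_convexHull ℝ).closure_eq] at hmem
  exact hF p hp.1 r hr.2.2 s hs.2.2 (Ne.symm hr.2.1) (Ne.symm hs.2.1) hrs
    (collinear_insert_of_mem_affineSpan_pair (convexHull_subset_affineSpan _ hmem))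

open scoped Classical in
theorem card_filter_mem_convexHull_erase {F : Finset (ℝ × ℝ)} (hF : GenPos F)
    (hcard : F.card = 4) :
    (F.filter fun p => p ∈ convexHull ℝ (F.erase p : Set (ℝ × ℝ))).card =
      if ConvexPos F then 0 else 1 := by
  split_ifs with h
  · rw [card_eq_zero, filter_eq_empty_iff]
    exact fun x hx => (mem_extremePoints_convexHull_iff_notMem_erase hx).1 (h x hx)
  · refine le_antisymm (card_filter_mem_convexHull_erase_le_one hF hcard) ?_
    rw [Nat.succ_le_iff, card_pos]
    unfold ConvexPos at h
    push Not at h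
    obtain ⟨x, hx, hx'⟩ := h
    rw [mem_extremePoints_convexHull_iff_notMem_erase hx, not_not] at hx'
    exact ⟨x, mem_filter.2 ⟨hx, hx'⟩⟩

/-- Twice the signed area of the triangle `p a b`. -/
def signedArea (p a b : ℝ × ℝ) : ℝ :=
  (a.1 - p.1) * (b.2 - p.2) - (a.2 - p.2) * (b.1 - p.1)

theorem collinear_of_signedArea_eq_zero {p a b : ℝ × ℝ} (hpa : p ≠ a)
    (h : signedArea p a b = 0) : Collinear ℝ ({p, a, b} : Set (ℝ × ℝ)) := by
  rw [collinear_iff_of_mem (p₀ := p) (by simp)]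
  unfold signedArea at h
  refine ⟨a - p, ?_⟩
  simp only [Set.mem_insert_iff, Set.mem_singleton_iff, forall_eq_or_imp, forall_eq]
  refine ⟨⟨0, by simp⟩, ⟨1, by simp⟩, ?_⟩
  by_cases h1 : a.1 - p.1 = 0
  · have h2 : a.2 - p.2 ≠ 0 := fun h2 =>
      hpa (Prod.ext (by linarith) (by linarith))
    refine ⟨(b.2 - p.2) / (a.2 - p.2), Prod.ext ?_ ?_⟩
    · have : b.1 - p.1 = 0 := by
        rw [h1] at h
        have : (a.2 - p.2) * (b.1 - p.1) = 0 := by linarith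
        exact (mul_eq_zero.1 this).resolve_left h2
      simp only [vadd_eq_add, Prod.fst_add, Prod.smul_fst, Prod.fst_sub, smul_eq_mul, h1]
      linarith
    · simp only [vadd_eq_add, Prod.snd_add, Prod.smul_snd, Prod.snd_sub, smul_eq_mul]
      field_simp
      ring
  · refine ⟨(b.1 - p.1) / (a.1 - p.1), Prod.ext ?_ ?_⟩
    · simp only [vadd_eq_add, Prod.fst_add, Prod.smul_fst, Prod.fst_sub, smul_eq_mul]
      field_simp
      ring
    · simp only [vadd_eq_add, Prod.snd_add, Prod.smul_snd, Prod.snd_sub, smul_eq_mul]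
      field_simp
      linarith

theorem GenPos.signedArea_ne_zero {P : Finset (ℝ × ℝ)} (hP : GenPos P) {p a b : ℝ × ℝ}
    (hp : p ∈ P) (ha : a ∈ P) (hb : b ∈ P) (hpa : p ≠ a) (hpb : p ≠ b) (hab : a ≠ b) :
    signedArea p a b ≠ 0 :=
  fun h => hP p hp a ha b hb hpa hpb hab (collinear_of_signedArea_eq_zero hpa h)

theorem mul_pos_iff_pos_iff_pos {x y : ℝ} (hx : x ≠ 0) (hy : y ≠ 0) :
    0 < x * y ↔ (0 < x ↔ 0 < y) := by
  rcases hx.lt_or_gt with hx | hx <;> rcases hy.lt_or_gt with hy | hy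
  · simp [mul_pos_of_neg_of_neg hx hy, hx.not_gt, hy.not_gt]
  · simp [(mul_neg_of_neg_of_pos hx hy).not_gt, hx.not_gt, hy]
  · simp [(mul_neg_of_pos_of_neg hx hy).not_gt, hx, hy.not_gt]
  · simp [mul_pos hx hy, hx, hy]

/-- A point off the lines spanned by a triangle lies in it exactly when the three triangles it
spans with the sides have the same orientation. -/
theorem mem_convexHull_triangle_iff {p a b c : ℝ × ℝ} (hab : signedArea p a b ≠ 0)
    (hac : signedArea p a c ≠ 0) (hbc : signedArea p b c ≠ 0) :
    p ∈ convexHull ℝ ({a, b, c} : Set (ℝ × ℝ)) ↔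
      (0 < signedArea p a b ↔ 0 < signedArea p b c) ∧
      (0 < signedArea p a c ↔ ¬ 0 < signedArea p b c) := by
  have hneg : (0 < signedArea p a c ↔ ¬ 0 < signedArea p b c) ↔
      0 < -signedArea p a c * signedArea p b c := by
    rw [mul_pos_iff_pos_iff_pos (neg_ne_zero.2 hac) hbc, Left.neg_pos_iff]
    have : signedArea p a c < 0 ↔ ¬ 0 < signedArea p a c := by
      rw [not_lt]; exact ⟨le_of_lt, fun h => lt_of_le_of_ne h hac⟩
    tauto
  rw [hneg, ← mul_pos_iff_pos_iff_pos hab hbc]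
  have hne1 := mul_ne_zero hab hbc
  have hne2 := mul_ne_zero (neg_ne_zero.2 hac) hbc
  constructor
  · intro h
    rw [convexHull_insert (by simp), convexHull_pair, mem_convexJoin] at h
    obtain ⟨a', ha', q, ⟨u, v, hu, hv, huv, rfl⟩, s, t, hs, ht, hst, rfl⟩ := h
    rw [Set.mem_singleton_iff] at ha'
    subst ha'
    obtain rfl : u = 1 - v := by linarith
    obtain rfl : s = 1 - t := by linarith
    constructor
    · refine lt_of_le_of_ne ?_ hne1.symm
      have : signedArea ((1 - t) • a' + t • ((1 - v) • b + v • c)) a' b *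
          signedArea ((1 - t) • a' + t • ((1 - v) • b + v • c)) b c =
          (t * v) * (1 - t) * signedArea a' b c ^ 2 := by
        simp only [signedArea, Prod.fst_add, Prod.snd_add, Prod.smul_fst, Prod.smul_snd,
          smul_eq_mul]
        ring
      rw [this]; positivity
    · refine lt_of_le_of_ne ?_ hne2.symm
      have : -signedArea ((1 - t) • a' + t • ((1 - v) • b + v • c)) a' c *
          signedArea ((1 - t) • a' + t • ((1 - v) • b + v • c)) b c =
          (t * (1 - v)) * (1 - t) * signedArea a' b c ^ 2 := by
        simp only [signedArea, Prod.fst_add, Prod.snd_add, Prod.smul_fst, Prod.smul_snd,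
          smul_eq_mul]
        ring
      rw [this]; positivity
  · rintro ⟨h1, h2⟩
    set x := signedArea p b c with hx
    set y := -signedArea p a c with hy
    set z := signedArea p a b with hz
    have hpos : 0 < x * (x + y + z) := by nlinarith [sq_nonneg x]
    have hS : x + y + z ≠ 0 := by rintro h; simp [h] at hpos
    have hxS : 0 ≤ x / (x + y + z) := by
      rw [div_nonneg_iff]
      rcases hbc.lt_or_gt with h | h
      · exact Or.inr ⟨h.le, by nlinarith⟩
      · exact Or.inl ⟨h.le, by nlinarith⟩
    have hratio : ∀ w, 0 < w * x → 0 ≤ w / (x + y + z) := by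
      intro w hw
      rw [div_nonneg_iff]
      rcases hbc.lt_or_gt with h | h
      · exact Or.inr ⟨by nlinarith, by nlinarith⟩
      · exact Or.inl ⟨by nlinarith, by nlinarith⟩
    have hmem : ∑ i, ![x / (x + y + z), y / (x + y + z), z / (x + y + z)] i • ![a, b, c] i ∈
        convexHull ℝ ({a, b, c} : Set (ℝ × ℝ)) := by
      refine (convex_convexHull ℝ _).sum_mem ?_ ?_ ?_
      · simpa [Fin.forall_fin_succ] using ⟨hxS, hratio y h2, hratio z h1⟩
      · simp only [Fin.sum_univ_three, Matrix.cons_val]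
        field_simp
      · intro i _
        exact subset_convexHull ℝ _ (by fin_cases i <;> simp)
    convert hmem using 1
    simp only [Fin.sum_univ_three, Matrix.cons_val]
    refine Prod.ext ?_ ?_
    · simp only [Prod.fst_add, Prod.smul_fst, smul_eq_mul]
      field_simp
      simp only [hx, hy, hz, signedArea]
      ring
    · simp only [Prod.snd_add, Prod.smul_snd, smul_eq_mul]
      field_simp
      simp only [hx, hy, hz, signedArea]
      ring

open scoped Classical in
/-- In general position, a point in the convex hull of four others lies in exactly two of the four
triangles they span. -/
theorem card_filter_mem_convexHull_erase_vertex {F : Finset (ℝ × ℝ)} {p : ℝ × ℝ} (hp : p ∉ F)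
    (hF : GenPos (insert p F)) (hcard : F.card = 4) :
    (F.filter fun x => p ∈ convexHull ℝ (F.erase x : Set (ℝ × ℝ))).card =
      if p ∈ convexHull ℝ (F : Set (ℝ × ℝ)) then 2 else 0 := by
  have hiff : p ∈ convexHull ℝ (F : Set (ℝ × ℝ)) ↔
      ∃ x ∈ F, p ∈ convexHull ℝ (F.erase x : Set (ℝ × ℝ)) := by
    constructor
    · intro h
      rw [convexHull_eq_union] at h
      simp only [Set.mem_iUnion] at h
      obtain ⟨t, htF, ht, hpt⟩ := h
      have htcard : t.card ≤ 3 := by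
        have := ht.card_le_finrank_succ
        simp only [Fintype.card_coe] at this
        refine this.trans ?_
        have := Submodule.finrank_le (vectorSpan ℝ (Set.range ((↑) : t → ℝ × ℝ)))
        simp only [Module.finrank_prod, Module.finrank_self] at this
        omega
      obtain ⟨x, hxF, hxt⟩ : ∃ x ∈ F, x ∉ t := exists_mem_notMem_of_card_lt_card (by omega)
      refine ⟨x, hxF, convexHull_mono ?_ hpt⟩
      intro y hy
      exact mem_coe.2 (mem_erase.2 ⟨fun h => hxt (h ▸ hy), htF hy⟩)
    · rintro ⟨x, -, h⟩
      exact convexHull_mono (coe_subset.2 (erase_subset _ _)) h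
  have htwo : (F.filter fun x => p ∈ convexHull ℝ (F.erase x : Set (ℝ × ℝ))).card = 0 ∨
      (F.filter fun x => p ∈ convexHull ℝ (F.erase x : Set (ℝ × ℝ))).card = 2 := by
    clear hiff
    obtain ⟨a, b, c, d, hab, hac, had, hbc, hbd, hcd, rfl⟩ := card_eq_four.1 hcard
    simp only [mem_insert, mem_singleton, not_or] at hp
    obtain ⟨hpa, hpb, hpc, hpd⟩ := hp
    have ab := hF.signedArea_ne_zero (p := p) (a := a) (b := b) (by simp) (by simp) (by simp)
      hpa hpb hab
    have ac := hF.signedArea_ne_zero (p := p) (a := a) (b := c) (by simp) (by simp) (by simp)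
      hpa hpc hac
    have ad := hF.signedArea_ne_zero (p := p) (a := a) (b := d) (by simp) (by simp) (by simp)
      hpa hpd had
    have bc := hF.signedArea_ne_zero (p := p) (a := b) (b := c) (by simp) (by simp) (by simp)
      hpb hpc hbc
    have bd := hF.signedArea_ne_zero (p := p) (a := b) (b := d) (by simp) (by simp) (by simp)
      hpb hpd hbd
    have cd := hF.signedArea_ne_zero (p := p) (a := c) (b := d) (by simp) (by simp) (by simp)
      hpc hpd hcd
    have ea : ((({a, b, c, d} : Finset (ℝ × ℝ)).erase a : Finset (ℝ × ℝ)) : Set (ℝ × ℝ)) =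
        {b, c, d} := by
      ext y; simp; grind
    have eb : ((({a, b, c, d} : Finset (ℝ × ℝ)).erase b : Finset (ℝ × ℝ)) : Set (ℝ × ℝ)) =
        {a, c, d} := by
      ext y; simp; grind
    have ec : ((({a, b, c, d} : Finset (ℝ × ℝ)).erase c : Finset (ℝ × ℝ)) : Set (ℝ × ℝ)) =
        {a, b, d} := by
      ext y; simp; grind
    have ed : ((({a, b, c, d} : Finset (ℝ × ℝ)).erase d : Finset (ℝ × ℝ)) : Set (ℝ × ℝ)) =
        {a, b, c} := by
      ext y; simp; grind
    have hGP : signedArea p a b * signedArea p c d - signedArea p a c * signedArea p b d +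
        signedArea p a d * signedArea p b c = 0 := by
      simp only [signedArea]; ring
    have h1 : ¬ (0 < signedArea p a b * signedArea p c d ∧
        ¬ 0 < signedArea p a c * signedArea p b d ∧
        0 < signedArea p a d * signedArea p b c) := by
      rintro ⟨h, h', h''⟩; linarith
    have h2 : ¬ (¬ 0 < signedArea p a b * signedArea p c d ∧
        0 < signedArea p a c * signedArea p b d ∧
        ¬ 0 < signedArea p a d * signedArea p b c) := by
      rintro ⟨h, h', h''⟩; linarith
    rw [mul_pos_iff_pos_iff_pos ab cd, mul_pos_iff_pos_iff_pos ac bd,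
      mul_pos_iff_pos_iff_pos ad bc] at h1 h2
    rw [card_filter, sum_insert (by simp [*]), sum_insert (by simp [*]), sum_insert (by simp [*]),
      sum_singleton, ea, eb, ec, ed, mem_convexHull_triangle_iff bc bd cd,
      mem_convexHull_triangle_iff ac ad cd, mem_convexHull_triangle_iff ab ad bd,
      mem_convexHull_triangle_iff ab ac bc]
    generalize (0 < signedArea p a b) = ab at *
    generalize (0 < signedArea p a c) = ac at *
    generalize (0 < signedArea p a d) = ad at *
    generalize (0 < signedArea p b c) = bc at *
    generalize (0 < signedArea p b d) = bd at *
    generalize (0 < signedArea p c d) = cd at *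
    clear * - h1 h2
    by_cases ab <;> by_cases ac <;> by_cases ad <;> by_cases bc <;> by_cases bd <;> by_cases cd <;>
      simp_all
  split_ifs with h
  · refine htwo.resolve_left fun h0 => ?_
    obtain ⟨x, hx, hpx⟩ := hiff.1 h
    exact filter_eq_empty_iff.1 (card_eq_zero.1 h0) hx hpx
  · rw [card_eq_zero, filter_eq_empty_iff]
    exact fun x hx hpx => h (hiff.2 ⟨x, hx, hpx⟩)

theorem ncard_extremePoints_convexHull_le (Q : Finset (ℝ × ℝ)) :
    (Set.extremePoints ℝ (convexHull ℝ (Q : Set (ℝ × ℝ)))).ncard ≤ Q.card := by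
  rw [← Set.ncard_coe_finset]
  exact Set.ncard_le_ncard extremePoints_convexHull_subset Q.finite_toSet

open scoped Classical in
/-- Five points in general position with `h` extreme points contain exactly `2 * h - 5` convex
quadrilaterals. -/
theorem card_filter_convexPos_erase_add_five {Q : Finset (ℝ × ℝ)} (hQ : GenPos Q)
    (hcard : Q.card = 5) :
    (Q.filter fun x => ConvexPos (Q.erase x)).card + 5 =
      2 * (Set.extremePoints ℝ (convexHull ℝ (Q : Set (ℝ × ℝ)))).ncard := by
  have hnot : (Q.filter fun x => ¬ ConvexPos (Q.erase x)).card =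
      2 * (Q.filter fun p => p ∈ convexHull ℝ (Q.erase p : Set (ℝ × ℝ))).card := by
    calc (Q.filter fun x => ¬ ConvexPos (Q.erase x)).card
        = ∑ x ∈ Q, ∑ p ∈ Q.erase x,
            if p ∈ convexHull ℝ ((Q.erase x).erase p : Set (ℝ × ℝ)) then 1 else 0 := by
          rw [card_filter]
          refine sum_congr rfl fun x hx => ?_
          rw [← card_filter, card_filter_mem_convexHull_erase (hQ.mono (erase_subset _ _))
            (by rw [card_erase_of_mem hx, hcard])]
          split_ifs <;> simp_all
      _ = ∑ p ∈ Q, ∑ x ∈ Q.erase p,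
            if p ∈ convexHull ℝ ((Q.erase p).erase x : Set (ℝ × ℝ)) then 1 else 0 := by
          rw [sum_comm' (t' := Q) (s' := fun p => Q.erase p)]
          · refine sum_congr rfl fun p _ => sum_congr rfl fun x _ => ?_
            rw [erase_right_comm]
          · intro x p
            simp only [mem_erase]
            tauto
      _ = 2 * (Q.filter fun p => p ∈ convexHull ℝ (Q.erase p : Set (ℝ × ℝ))).card := by
          rw [card_filter, mul_sum]
          refine sum_congr rfl fun p hp => ?_
          rw [← card_filter, card_filter_mem_convexHull_erase_vertex (notMem_erase _ _)
            (by rwa [insert_erase hp]) (by rw [card_erase_of_mem hp, hcard])]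
          split_ifs <;> rfl
  have hext : (Set.extremePoints ℝ (convexHull ℝ (Q : Set (ℝ × ℝ)))).ncard =
      (Q.filter fun p => ¬ p ∈ convexHull ℝ (Q.erase p : Set (ℝ × ℝ))).card := by
    rw [← Set.ncard_coe_finset]
    congr 1
    ext x
    rw [mem_coe, mem_filter]
    constructor
    · intro h
      have hx : x ∈ Q := extremePoints_convexHull_subset h
      exact ⟨hx, (mem_extremePoints_convexHull_iff_notMem_erase hx).1 h⟩
    · rintro ⟨hx, h⟩
      exact (mem_extremePoints_convexHull_iff_notMem_erase hx).2 h
  have h1 := card_filter_add_card_filter_not (s := Q) (fun x => ConvexPos (Q.erase x))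
  have h2 := card_filter_add_card_filter_not (s := Q)
    (fun p => p ∈ convexHull ℝ (Q.erase p : Set (ℝ × ℝ)))
  omega

open scoped Classical in
/-- Pairs of γ-points of triples of `P`, regrouped by the five points involved. -/
theorem sum_gammaCount_choose_two_eq_sum_powersetCard_five (P : Finset (ℝ × ℝ)) :
    ∑ T ∈ P.powersetCard 3, (gammaCount P T).choose 2 =
      ∑ Q ∈ P.powersetCard 5, ((Q.filter fun x => ConvexPos (Q.erase x)).card).choose 2 := by
  unfold gammaCount
  simp only [← card_powersetCard]
  rw [← card_sigma, ← card_sigma]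
  have hins : ∀ {T S : Finset (ℝ × ℝ)} {x}, Disjoint T S → S.card = 2 → x ∈ S →
      ∃ y ∈ S, insert y T = (T ∪ S).erase x ∧ insert x T = (T ∪ S).erase y := by
    intro T S x hd hS hx
    obtain ⟨u, v, huv, rfl⟩ := card_eq_two.1 hS
    simp only [disjoint_insert_right, disjoint_singleton_right] at hd
    simp only [mem_insert, mem_singleton] at hx
    rcases hx with rfl | rfl
    · refine ⟨v, by simp, ?_, ?_⟩ <;> ext z <;> simp <;> grind
    · refine ⟨u, by simp, ?_, ?_⟩ <;> ext z <;> simp <;> grind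
  refine card_nbij' (fun A => ⟨A.1 ∪ A.2, A.2⟩) (fun A => ⟨A.1 \ A.2, A.2⟩) ?_ ?_ ?_ ?_
  · rintro ⟨T, S⟩ h
    simp only [mem_coe, mem_sigma, mem_powersetCard] at h ⊢
    obtain ⟨⟨hTP, hT⟩, hSP, hS⟩ := h
    have hd : Disjoint T S := by
      rw [disjoint_right]
      intro x hx
      exact (mem_sdiff.1 (mem_filter.1 (hSP hx)).1).2
    refine ⟨⟨union_subset hTP fun x hx => (mem_sdiff.1 (mem_filter.1 (hSP hx)).1).1,
      by rw [card_union_of_disjoint hd, hT, hS]⟩, fun x hx => ?_, hS⟩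
    obtain ⟨y, hy, hyx, -⟩ := hins hd hS hx
    rw [mem_filter, ← hyx]
    exact ⟨mem_union_right _ hx, (mem_filter.1 (hSP hy)).2⟩
  · rintro ⟨Q, S⟩ h
    simp only [mem_coe, mem_sigma, mem_powersetCard] at h ⊢
    obtain ⟨⟨hQP, hQ⟩, hSQ, hS⟩ := h
    have hSQ' : S ⊆ Q := hSQ.trans (filter_subset _ _)
    refine ⟨⟨sdiff_subset.trans hQP, by rw [card_sdiff_of_subset hSQ', hQ, hS]⟩,
      fun x hx => ?_, hS⟩
    obtain ⟨y, hy, -, hxy⟩ := hins sdiff_disjoint hS hx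
    rw [sdiff_union_of_subset hSQ'] at hxy
    rw [mem_filter, IsGammaPt, hxy]
    exact ⟨mem_sdiff.2 ⟨hQP (hSQ' hx), fun h => (mem_sdiff.1 h).2 hx⟩, (mem_filter.1 (hSQ hy)).2⟩
  · rintro ⟨T, S⟩ h
    simp only [mem_coe, mem_sigma, mem_powersetCard] at h
    have hd : Disjoint T S := by
      rw [disjoint_right]
      intro x hx
      exact (mem_sdiff.1 (mem_filter.1 (h.2.1 hx)).1).2
    simp [union_sdiff_cancel_right hd]
  · rintro ⟨Q, S⟩ h
    simp only [mem_coe, mem_sigma, mem_powersetCard] at h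
    simp [union_eq_left.2 (h.2.1.trans (filter_subset _ _))]

open scoped Classical in
/-- `hullCount` counts subsets as finite sets, although it is phrased with their coercions to
sets. -/
theorem hullCount_eq_card_filter (P : Finset (ℝ × ℝ)) (k j : ℕ) :
    hullCount P k j = ((P.powersetCard k).filter fun S : Finset (ℝ × ℝ) =>
      (Set.extremePoints ℝ (convexHull ℝ (S : Set (ℝ × ℝ)))).ncard = j).card := by
  have himage : (do let S ← P.powersetCard k; pure (S : Set (ℝ × ℝ))) =
      (P.powersetCard k).image fun S : Finset (ℝ × ℝ) => (S : Set (ℝ × ℝ)) := by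
    ext x
    simp [eq_comm]
  rw [hullCount, himage, filter_image, card_image_of_injective _ coe_injective]

/-- For any point placement `P`, `∑_T C(γ_T, 2) = 10·P₅(P) + 3·U(P)`. -/
theorem sum_gamma_choose_two (P : Finset (ℝ × ℝ)) (n : ℕ) (hgp : GenPos P)
    (hcard : P.card = n) :
    ∑ T ∈ P.powersetCard 3, (gammaCount P T).choose 2 =
      10 * hullCount P 5 5 + 3 * hullCount P 5 4 := by
  classical
  rw [sum_gammaCount_choose_two_eq_sum_powersetCard_five, hullCount_eq_card_filter,
    hullCount_eq_card_filter, card_filter, card_filter, mul_sum, mul_sum, ← sum_add_distrib]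
  refine sum_congr rfl fun Q hQ => ?_
  rw [mem_powersetCard] at hQ
  have hc := card_filter_convexPos_erase_add_five (hgp.mono hQ.1) hQ.2
  have hle := ncard_extremePoints_convexHull_le Q
  rw [hQ.2] at hle
  generalize (Set.extremePoints ℝ (convexHull ℝ (Q : Set (ℝ × ℝ)))).ncard = h at hc hle ⊢
  generalize (Q.filter fun x => ConvexPos (Q.erase x)).card = c at hc ⊢
  obtain rfl : c = 2 * h - 5 := by omega
  interval_cases h <;> simp_all; rfl
end

section
/- For any point placement P of n ≥ 5 points, 32·P₅(P) = 4·Σ_T γ_T² − (3n − 8)·Σ_T γ_T + 12·C(n,5), where both sums range over all 3-element subsets T of P. -/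
open Finset

section Counting

variable {α : Type*} [DecidableEq α]

theorem sum_sq_card_filter {β γ : Type*} (X : Finset β) (Y : Finset γ) (r : β → γ → Prop)
    [∀ x y, Decidable (r x y)] :
    ∑ x ∈ X, (#{y ∈ Y | r x y} : ℤ) ^ 2 =
      ∑ y ∈ Y, ∑ z ∈ Y, (#{x ∈ X | r x y ∧ r x z} : ℤ) := by
  simp only [card_filter, sq, Nat.cast_sum, sum_mul_sum]
  rw [sum_comm]
  refine sum_congr rfl fun y _ => ?_
  rw [sum_comm]
  refine sum_congr rfl fun z _ => sum_congr rfl fun x _ => ?_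
  by_cases h : r x y <;> simp [h]

/-- Four-element sets have `4` common triples with themselves, and two distinct ones have as many
common subsets of size `3` as common supersets of size `5`. -/
theorem card_common_subsets_sub_card_common_supersets {P S S' : Finset α} (hS : S ⊆ P)
    (hS' : S' ⊆ P) (h4 : #S = 4) (h4' : #S' = 4) :
    (#{T ∈ P.powersetCard 3 | T ⊆ S ∧ T ⊆ S'} : ℤ) =
      #{Q ∈ P.powersetCard 5 | S ⊆ Q ∧ S' ⊆ Q} + if S = S' then 8 - (#P : ℤ) else 0 := by
  have h₁ : {T ∈ P.powersetCard 3 | T ⊆ S ∧ T ⊆ S'} = (S ∩ S').powersetCard 3 := by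
    ext T
    simp only [mem_filter, mem_powersetCard, subset_inter_iff]
    exact ⟨fun h => ⟨h.2, h.1.2⟩, fun h => ⟨⟨h.1.1.trans hS, h.2⟩, h.1⟩⟩
  have h₂ : {Q ∈ P.powersetCard 5 | S ⊆ Q ∧ S' ⊆ Q} =
      {Q ∈ P.powersetCard 5 | S ∪ S' ⊆ Q} := by
    simp only [union_subset_iff]
  have hP : #(S ∪ S') ≤ #P := card_le_card (union_subset hS hS')
  have hun := card_union_add_card_inter S S'
  rw [h₁, h₂, card_powersetCard]
  by_cases hle : #(S ∪ S') ≤ 5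
  · rw [card_filter_powersetCard_subset _ _ _ (union_subset hS hS') hle]
    split_ifs with h
    · subst h
      rw [inter_self, union_self, h4] at *
      norm_num [Nat.choose]
      omega
    · have hne : #(S ∪ S') ≠ 4 := fun hc => h <| by
        rw [eq_of_subset_of_card_le (subset_union_left : S ⊆ S ∪ S') (by omega),
          ← eq_of_subset_of_card_le (subset_union_right : S' ⊆ S ∪ S') (by omega)]
      have hge : #S ≤ #(S ∪ S') := card_le_card subset_union_left
      have hu : #(S ∪ S') = 5 := by omega
      have hi : #(S ∩ S') = 3 := by omega
      simp [hu, hi]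
  · have hne : S ≠ S' := by
      rintro rfl
      rw [union_self] at hle
      omega
    rw [if_neg hne, Nat.choose_eq_zero_of_lt (by omega), filter_false_of_mem]
    · simp
    · intro Q hQ hsub
      exact hle ((card_le_card hsub).trans_eq (mem_powersetCard.1 hQ).2)

theorem sum_card_filter_subset_powersetCard_three (P : Finset α) {𝒜 : Finset (Finset α)}
    (h𝒜 : 𝒜 ⊆ P.powersetCard 4) :
    ∑ T ∈ P.powersetCard 3, (#{S ∈ 𝒜 | T ⊆ S} : ℤ) = 4 * #𝒜 := by
  have h := sum_card_bipartiteAbove_eq_sum_card_bipartiteBelow (s := P.powersetCard 3) (t := 𝒜)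
    (fun T S => T ⊆ S)
  simp only [bipartiteAbove, bipartiteBelow] at h
  rw [← Nat.cast_sum, h, sum_const_nat (m := 4)]
  · push_cast; ring
  · intro S hS
    obtain ⟨hSP, h4⟩ := mem_powersetCard.1 (h𝒜 hS)
    have : {T ∈ P.powersetCard 3 | T ⊆ S} = S.powersetCard 3 := by
      ext T
      simp only [mem_filter, mem_powersetCard]
      exact ⟨fun h => ⟨h.2, h.1.2⟩, fun h => ⟨⟨h.1.trans hSP, h.2⟩, h.1⟩⟩
    rw [this, card_powersetCard, h4]
    rfl

theorem sum_card_filter_subset_powersetCard_five (P : Finset α) {𝒜 : Finset (Finset α)}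
    (h𝒜 : 𝒜 ⊆ P.powersetCard 4) :
    ∑ Q ∈ P.powersetCard 5, (#{S ∈ 𝒜 | S ⊆ Q} : ℤ) = ((#P : ℤ) - 4) * #𝒜 := by
  have h := sum_card_bipartiteAbove_eq_sum_card_bipartiteBelow (s := P.powersetCard 5) (t := 𝒜)
    (fun Q S => S ⊆ Q)
  simp only [bipartiteAbove, bipartiteBelow] at h
  rw [← Nat.cast_sum, h, sum_const_nat (m := #P - 4)]
  · rcases 𝒜.eq_empty_or_nonempty with rfl | ⟨S, hS⟩
    · simp
    · obtain ⟨hSP, h4⟩ := mem_powersetCard.1 (h𝒜 hS)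
      have := card_le_card hSP
      push_cast [Nat.cast_sub (h4 ▸ this)]
      ring
  · intro S hS
    obtain ⟨hSP, h4⟩ := mem_powersetCard.1 (h𝒜 hS)
    rw [card_filter_powersetCard_subset _ _ _ hSP (by omega), h4]
    simp

theorem sum_sq_card_filter_subset_powersetCard (P : Finset α) {𝒜 : Finset (Finset α)}
    (h𝒜 : 𝒜 ⊆ P.powersetCard 4) :
    ∑ T ∈ P.powersetCard 3, (#{S ∈ 𝒜 | T ⊆ S} : ℤ) ^ 2 =
      ∑ Q ∈ P.powersetCard 5, (#{S ∈ 𝒜 | S ⊆ Q} : ℤ) ^ 2 + (8 - (#P : ℤ)) * #𝒜 := by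
  rw [sum_sq_card_filter, sum_sq_card_filter]
  have h : ∀ S ∈ 𝒜, ∑ S' ∈ 𝒜, (#{T ∈ P.powersetCard 3 | T ⊆ S ∧ T ⊆ S'} : ℤ) =
      ∑ S' ∈ 𝒜, (#{Q ∈ P.powersetCard 5 | S ⊆ Q ∧ S' ⊆ Q} : ℤ) + (8 - (#P : ℤ)) := by
    intro S hS
    rw [sum_congr rfl fun S' hS' => card_common_subsets_sub_card_common_supersets
      (mem_powersetCard.1 (h𝒜 hS)).1 (mem_powersetCard.1 (h𝒜 hS')).1
      (mem_powersetCard.1 (h𝒜 hS)).2 (mem_powersetCard.1 (h𝒜 hS')).2, sum_add_distrib]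
    simp [hS]
  rw [sum_congr rfl h, sum_add_distrib]
  rw [sum_const, nsmul_eq_mul, mul_comm (#𝒜 : ℤ)]

theorem card_filter_insert {P T : Finset α} (hT : T ⊆ P) {k : ℕ} (hk : #T = k)
    (C : Finset α → Prop) [DecidablePred C] :
    #{x ∈ P \ T | C (insert x T)} = #{S ∈ (P.powersetCard (k + 1)).filter C | T ⊆ S} := by
  refine card_nbij (fun x => insert x T) ?_ ?_ ?_
  · intro x hx
    simp only [coe_filter, mem_filter, mem_sdiff, mem_powersetCard, Set.mem_ofPred_eq] at hx ⊢
    exact ⟨⟨⟨insert_subset hx.1.1 hT, by rw [card_insert_of_notMem hx.1.2, hk]⟩, hx.2⟩,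
      subset_insert _ _⟩
  · intro x hx y hy hxy
    simp only [coe_filter, mem_sdiff, Set.mem_ofPred_eq] at hx hy
    exact (insert_inj hx.1.2).1 hxy
  · intro S hS
    simp only [coe_filter, mem_filter, mem_powersetCard, Set.mem_ofPred_eq] at hS
    obtain ⟨⟨⟨hSP, hSk⟩, hC⟩, hTS⟩ := hS
    obtain ⟨x, hxT, rfl⟩ := (covBy_iff_exists_insert.1
      (covBy_iff_card_sdiff_eq_one.2 ⟨hTS, by rw [card_sdiff_of_subset hTS]; omega⟩))
    refine ⟨x, ?_, rfl⟩
    simp only [coe_filter, mem_sdiff, Set.mem_ofPred_eq]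
    exact ⟨⟨hSP (mem_insert_self _ _), hxT⟩, hC⟩

theorem card_filter_erase {P Q : Finset α} (hQ : Q ⊆ P) {k : ℕ} (hk : #Q = k + 1)
    (C : Finset α → Prop) [DecidablePred C] :
    #{S ∈ (P.powersetCard k).filter C | S ⊆ Q} = #{x ∈ Q | C (Q.erase x)} := by
  symm
  refine card_nbij (fun x => Q.erase x) ?_ ?_ ?_
  · intro x hx
    simp only [coe_filter, mem_filter, mem_powersetCard, Set.mem_ofPred_eq] at hx ⊢
    exact ⟨⟨⟨(erase_subset _ _).trans hQ, by rw [card_erase_of_mem hx.1, hk]; rfl⟩, hx.2⟩,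
      erase_subset _ _⟩
  · intro x hx y hy hxy
    simp only [coe_filter, Set.mem_ofPred_eq] at hx hy
    exact (erase_inj Q hx.1).1 hxy
  · intro S hS
    simp only [coe_filter, mem_filter, mem_powersetCard, Set.mem_ofPred_eq] at hS
    obtain ⟨⟨⟨hSP, hSk⟩, hC⟩, hSQ⟩ := hS
    obtain ⟨x, hx⟩ := card_eq_one.1 (show #(Q \ S) = 1 by rw [card_sdiff_of_subset hSQ]; omega)
    have hS : Q.erase x = S := by
      rw [← sdiff_singleton_eq_erase, ← hx, Finset.sdiff_sdiff_eq_self hSQ]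
    refine ⟨x, ?_, hS⟩
    simp only [coe_filter, Set.mem_ofPred_eq, hS]
    exact ⟨(mem_sdiff.1 (hx ▸ mem_singleton_self x : x ∈ Q \ S)).1, hC⟩

end Counting

theorem convexPos_iff_notMem_convexHull_erase {S : Finset (ℝ × ℝ)} :
    ConvexPos S ↔ ∀ x ∈ S, x ∉ convexHull ℝ (S.erase x : Set (ℝ × ℝ)) := by
  refine forall₂_congr fun x hx => ?_
  constructor
  · intro hext hmem
    rw [(convex_convexHull ℝ _).mem_extremePoints_iff_mem_sdiff_convexHull_sdiff] at hext
    refine hext.2 (convexHull_mono ?_ hmem)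
    rw [coe_erase]
    exact Set.sdiff_subset_sdiff_left (subset_convexHull ℝ _)
  · intro hmem
    by_contra hext
    have hsub : Set.extremePoints ℝ (convexHull ℝ (S : Set (ℝ × ℝ))) ⊆ (S.erase x : Finset _) := by
      intro y hy
      rw [mem_coe, mem_erase]
      exact ⟨fun h => hext (h ▸ hy), extremePoints_convexHull_subset hy⟩
    have hKM := closure_convexHull_extremePoints
      (S.finite_toSet.isCompact_convexHull (𝕜 := ℝ)) (convex_convexHull ℝ (S : Set (ℝ × ℝ)))
    apply hmem
    have hx' : x ∈ convexHull ℝ (S : Set (ℝ × ℝ)) := subset_convexHull ℝ _ hx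
    rw [← hKM] at hx'
    exact closure_minimal (convexHull_mono hsub)
      ((S.erase x).finite_toSet.isClosed_convexHull (𝕜 := ℝ)) hx'

theorem ConvexPos.mono {S T : Finset (ℝ × ℝ)} (hT : ConvexPos T) (h : S ⊆ T) : ConvexPos S := by
  rw [convexPos_iff_notMem_convexHull_erase] at hT ⊢
  exact fun x hx hmem => hT x (h hx) (convexHull_mono (coe_subset.2 (erase_subset_erase x h)) hmem)

theorem convexPos_iff_forall_erase {Q : Finset (ℝ × ℝ)} (hQ : 5 ≤ #Q) :
    ConvexPos Q ↔ ∀ x ∈ Q, ConvexPos (Q.erase x) := by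
  refine ⟨fun h x _ => h.mono (erase_subset _ _), fun h => ?_⟩
  rw [convexPos_iff_notMem_convexHull_erase]
  intro x hx hmem
  rw [convexHull_eq_union] at hmem
  simp only [Set.mem_iUnion] at hmem
  obtain ⟨t, hts, hind, hxt⟩ := hmem
  rw [coe_subset] at hts
  have ht3 : #t ≤ 3 := by
    have := hind.card_le_finrank_succ
    rw [Fintype.card_coe] at this
    have hle := Submodule.finrank_le (vectorSpan ℝ (Set.range ((↑) : t → ℝ × ℝ)))
    have h2 : Module.finrank ℝ (ℝ × ℝ) = 2 := by simp
    omega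
  have hcard : #t < #(Q.erase x) := by rw [card_erase_of_mem hx]; omega
  obtain ⟨y, hy, hyt⟩ := exists_mem_notMem_of_card_lt_card hcard
  obtain ⟨hyx, hyQ⟩ := mem_erase.1 hy
  refine convexPos_iff_notMem_convexHull_erase.1 (h y hyQ) x (mem_erase.2 ⟨hyx.symm, hx⟩)
    (convexHull_mono (coe_subset.2 fun z hz => ?_) hxt)
  obtain ⟨hzx, hzQ⟩ := mem_erase.1 (hts hz)
  exact mem_erase.2 ⟨hzx, mem_erase.2 ⟨fun h => hyt (h ▸ hz), hzQ⟩⟩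

/-- Twice the signed area of the triangle `p q r`. -/
def orientDet (p q r : ℝ × ℝ) : ℝ :=
  (q.1 - p.1) * (r.2 - p.2) - (q.2 - p.2) * (r.1 - p.1)

theorem collinear_of_orientDet_eq_zero {p q r : ℝ × ℝ} (hpq : p ≠ q) (h : orientDet p q r = 0) :
    Collinear ℝ ({p, q, r} : Set (ℝ × ℝ)) := by
  rw [collinear_iff_of_mem (p₀ := p) (by simp)]
  refine ⟨q - p, ?_⟩
  simp only [orientDet] at h
  simp only [Set.mem_insert_iff, Set.mem_singleton_iff, forall_eq_or_imp, forall_eq]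
  refine ⟨⟨0, by simp⟩, ⟨1, by simp⟩, ?_⟩
  by_cases h1 : q.1 - p.1 = 0
  · have h2 : q.2 - p.2 ≠ 0 := fun h2 => hpq (Prod.ext (by linarith) (by linarith))
    refine ⟨(r.2 - p.2) / (q.2 - p.2), Prod.ext ?_ ?_⟩
    · have : (q.2 - p.2) * (r.1 - p.1) = 0 := by rw [h1] at h; linarith
      have := (mul_eq_zero.1 this).resolve_left h2
      simp [h1]
      linarith
    · simp
      field_simp
      ring
  · refine ⟨(r.1 - p.1) / (q.1 - p.1), Prod.ext ?_ ?_⟩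
    · simp
      field_simp
      ring
    · simp
      field_simp
      linarith

theorem GenPos.orientDet_ne_zero {P : Finset (ℝ × ℝ)} (hP : GenPos P) {p q r : ℝ × ℝ}
    (hp : p ∈ P) (hq : q ∈ P) (hr : r ∈ P) (hpq : p ≠ q) (hpr : p ≠ r) (hqr : q ≠ r) :
    orientDet p q r ≠ 0 :=
  fun h => hP p hp q hq r hr hpq hpr hqr (collinear_of_orientDet_eq_zero hpq h)

theorem mem_convexHull_triple {a b c x : ℝ × ℝ} :
    x ∈ convexHull ℝ ({a, b, c} : Set (ℝ × ℝ)) ↔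
      ∃ u v w : ℝ, 0 ≤ u ∧ 0 ≤ v ∧ 0 ≤ w ∧ u + v + w = 1 ∧ u • a + v • b + w • c = x := by
  constructor
  · rw [convexHull_insert (by simp), convexHull_pair, mem_convexJoin]
    rintro ⟨_, rfl, _, ⟨v, w, hv, hw, hvw, rfl⟩, s, t, hs, ht, hst, rfl⟩
    refine ⟨s, t * v, t * w, hs, by positivity, by positivity, ?_, ?_⟩
    · rw [add_assoc, ← mul_add, hvw, mul_one, hst]
    · rw [smul_add, smul_smul, smul_smul, add_assoc]
  · rintro ⟨u, v, w, hu, hv, hw, hsum, rfl⟩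
    have := (convex_convexHull ℝ ({a, b, c} : Set (ℝ × ℝ))).sum_mem (t := univ)
      (w := ![u, v, w]) (z := ![a, b, c])
      (by simp [Fin.forall_fin_succ, hu, hv, hw]) (by simpa [Fin.sum_univ_three] using hsum)
      (fun i _ => subset_convexHull ℝ _ (by fin_cases i <;> simp))
    simpa [Fin.sum_univ_three] using this

/-- The product of the orientations of the four triangles spanned by four points. It is symmetric
in the points. -/
def orientProd (a b c d : ℝ × ℝ) : ℝ :=
  orientDet b c d * orientDet a c d * orientDet a b d * orientDet a b c

theorem orientProd_nonpos_of_mem_convexHull {a b c d : ℝ × ℝ}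
    (h : d ∈ convexHull ℝ ({a, b, c} : Set (ℝ × ℝ))) : orientProd a b c d ≤ 0 := by
  obtain ⟨u, v, w, hu, hv, hw, hsum, rfl⟩ := mem_convexHull_triple.1 h
  obtain rfl : u = 1 - v - w := by linarith
  have : orientProd a b c ((1 - v - w) • a + v • b + w • c) =
      -((1 - v - w) * v * w * orientDet a b c ^ 4) := by
    simp [orientProd, orientDet]
    ring
  rw [this]
  have := mul_nonneg (mul_nonneg (mul_nonneg hu hv) hw) (by positivity : 0 ≤ orientDet a b c ^ 4)
  linarith

theorem mem_convexHull_of_orientDet {a b c d : ℝ × ℝ} (ha : 0 < orientDet d b c * orientDet a b c)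
    (hb : 0 < orientDet a d c * orientDet a b c) (hc : 0 < orientDet a b d * orientDet a b c) :
    d ∈ convexHull ℝ ({a, b, c} : Set (ℝ × ℝ)) := by
  have h0 : orientDet a b c ≠ 0 := fun h => by simp [h] at ha
  have hpos : 0 < orientDet a b c ^ 2 := by positivity
  refine mem_convexHull_triple.2 ⟨orientDet d b c * orientDet a b c / orientDet a b c ^ 2,
    orientDet a d c * orientDet a b c / orientDet a b c ^ 2,
    orientDet a b d * orientDet a b c / orientDet a b c ^ 2,
    by positivity, by positivity, by positivity, ?_, Prod.ext ?_ ?_⟩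
  · field_simp
    simp only [orientDet]
    ring
  · simp
    field_simp
    simp only [orientDet]
    ring
  · simp
    field_simp
    simp only [orientDet]
    ring

theorem exists_mem_convexHull_of_orientProd_neg {a b c d : ℝ × ℝ} (h : orientProd a b c d < 0) :
    a ∈ convexHull ℝ ({b, c, d} : Set (ℝ × ℝ)) ∨ b ∈ convexHull ℝ ({a, c, d} : Set (ℝ × ℝ)) ∨
      c ∈ convexHull ℝ ({a, b, d} : Set (ℝ × ℝ)) ∨ d ∈ convexHull ℝ ({a, b, c} : Set (ℝ × ℝ)) := by
  have h₁ : orientDet b a d = -orientDet a b d := by simp only [orientDet]; ring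
  have h₂ : orientDet b c a = orientDet a b c := by simp only [orientDet]; ring
  have h₃ : orientDet a c b = -orientDet a b c := by simp only [orientDet]; ring
  have h₄ : orientDet c b d = -orientDet b c d := by simp only [orientDet]; ring
  have h₅ : orientDet d b c = orientDet b c d := by simp only [orientDet]; ring
  have h₆ : orientDet a d c = -orientDet a c d := by simp only [orientDet]; ring
  have ha := @mem_convexHull_of_orientDet b c d a
  have hb := @mem_convexHull_of_orientDet a c d b
  have hc := @mem_convexHull_of_orientDet a b d c
  have hd := @mem_convexHull_of_orientDet a b c d
  simp only [h₁, h₂, h₃, h₄, h₅, h₆, neg_mul, Left.neg_pos_iff] at ha hb hc hd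
  simp only [orientProd] at h
  generalize orientDet b c d = A at *
  generalize orientDet a c d = B at *
  generalize orientDet a b d = C at *
  generalize orientDet a b c = D at *
  simp only [mul_neg_iff, mul_pos_iff] at *
  grind

theorem convexPos_iff_orientProd_pos {a b c d : ℝ × ℝ} (hab : a ≠ b) (hac : a ≠ c) (had : a ≠ d)
    (hbc : b ≠ c) (hbd : b ≠ d) (hcd : c ≠ d) (h0 : orientProd a b c d ≠ 0) :
    ConvexPos {a, b, c, d} ↔ 0 < orientProd a b c d := by
  have ea : ({a, b, c, d} : Finset (ℝ × ℝ)).erase a = {b, c, d} := by grind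
  have eb : ({a, b, c, d} : Finset (ℝ × ℝ)).erase b = {a, c, d} := by grind
  have ec : ({a, b, c, d} : Finset (ℝ × ℝ)).erase c = {a, b, d} := by grind
  have ed : ({a, b, c, d} : Finset (ℝ × ℝ)).erase d = {a, b, c} := by grind
  rw [convexPos_iff_notMem_convexHull_erase]
  simp only [mem_insert, mem_singleton, forall_eq_or_imp, forall_eq, ea, eb, ec, ed, coe_insert,
    coe_singleton]
  constructor
  · rintro ⟨ha, hb, hc, hd⟩
    by_contra hn
    have := exists_mem_convexHull_of_orientProd_neg (lt_of_le_of_ne (not_lt.1 hn) h0)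
    tauto
  · intro hpos
    refine ⟨fun h => ?_, fun h => ?_, fun h => ?_, fun h => ?_⟩ <;>
      refine (orientProd_nonpos_of_mem_convexHull h).not_gt (hpos.trans_eq ?_) <;>
      simp only [orientProd, orientDet] <;> ring

theorem odd_sum_ite_of_iff {p q r s t : Prop} [Decidable p] [Decidable q] [Decidable r]
    [Decidable s] [Decidable t] (h : (((p ↔ q) ↔ r) ↔ s) ↔ t) :
    Odd ((if p then 1 else 0) + ((if q then 1 else 0) + ((if r then 1 else 0) +
      ((if s then 1 else 0) + if t then 1 else 0)))) := by
  by_cases p <;> by_cases q <;> by_cases r <;> by_cases s <;> simp_all <;> decide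

theorem odd_card_filter_convexPos_erase {Q : Finset (ℝ × ℝ)} [DecidablePred ConvexPos]
    (hgp : GenPos Q) (hQ : #Q = 5) : Odd #{x ∈ Q | ConvexPos (Q.erase x)} := by
  obtain ⟨a, R, haQ, rfl, hR⟩ := card_eq_succ.1 hQ
  obtain ⟨b, U, hbQ, rfl, hU⟩ := card_eq_succ.1 hR
  obtain ⟨c, d, e, hcd, hce, hde, rfl⟩ := card_eq_three.1 hU
  simp only [mem_insert, mem_singleton, not_or] at haQ hbQ
  obtain ⟨hab, hac, had, hae⟩ := haQ
  obtain ⟨hbc, hbd, hbe⟩ := hbQ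
  have ea : ({a, b, c, d, e} : Finset (ℝ × ℝ)).erase a = {b, c, d, e} := by grind
  have eb : ({a, b, c, d, e} : Finset (ℝ × ℝ)).erase b = {a, c, d, e} := by grind
  have ec : ({a, b, c, d, e} : Finset (ℝ × ℝ)).erase c = {a, b, d, e} := by grind
  have ed : ({a, b, c, d, e} : Finset (ℝ × ℝ)).erase d = {a, b, c, e} := by grind
  have ee : ({a, b, c, d, e} : Finset (ℝ × ℝ)).erase e = {a, b, c, d} := by grind
  have h0 {p q r s : ℝ × ℝ} (hp : p ∈ ({a, b, c, d, e} : Finset (ℝ × ℝ)))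
      (hq : q ∈ ({a, b, c, d, e} : Finset (ℝ × ℝ))) (hr : r ∈ ({a, b, c, d, e} : Finset (ℝ × ℝ)))
      (hs : s ∈ ({a, b, c, d, e} : Finset (ℝ × ℝ))) (hpq : p ≠ q) (hpr : p ≠ r) (hps : p ≠ s)
      (hqr : q ≠ r) (hqs : q ≠ s) (hrs : r ≠ s) : orientProd p q r s ≠ 0 :=
    mul_ne_zero (mul_ne_zero (mul_ne_zero (hgp.orientDet_ne_zero hq hr hs hqr hqs hrs)
      (hgp.orientDet_ne_zero hp hr hs hpr hps hrs)) (hgp.orientDet_ne_zero hp hq hs hpq hps hqs))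
      (hgp.orientDet_ne_zero hp hq hr hpq hpr hqr)
  have na : orientProd b c d e ≠ 0 := by apply h0 <;> first | assumption | simp
  have nb : orientProd a c d e ≠ 0 := by apply h0 <;> first | assumption | simp
  have nc : orientProd a b d e ≠ 0 := by apply h0 <;> first | assumption | simp
  have nd : orientProd a b c e ≠ 0 := by apply h0 <;> first | assumption | simp
  have ne : orientProd a b c d ≠ 0 := by apply h0 <;> first | assumption | simp
  have hpos : 0 < orientProd b c d e * orientProd a c d e * orientProd a b d e *
      orientProd a b c e * orientProd a b c d := by
    refine lt_of_le_of_ne ?_ (by simp [*] : _ ≠ _).symm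
    refine (sq_nonneg (orientDet a b c * orientDet a b d * orientDet a b e * orientDet a c d *
      orientDet a c e * orientDet a d e * orientDet b c d * orientDet b c e * orientDet b d e *
      orientDet c d e)).trans_eq ?_
    simp only [orientProd]
    ring
  rw [card_filter, sum_insert (by simp [*]), sum_insert (by simp [*]), sum_insert (by simp [*]),
    sum_insert (by simp [*]), sum_singleton, ea, eb, ec, ed, ee]
  simp only [convexPos_iff_orientProd_pos hbc hbd hbe hcd hce hde na,
    convexPos_iff_orientProd_pos hac had hae hcd hce hde nb,
    convexPos_iff_orientProd_pos hab had hae hbd hbe hde nc,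
    convexPos_iff_orientProd_pos hab hac hae hbc hbe hce nd,
    convexPos_iff_orientProd_pos hab hac had hbc hbd hcd ne]
  rw [mul_pos_iff_pos_iff_pos (by simp [*]) ne, mul_pos_iff_pos_iff_pos (by simp [*]) nd,
    mul_pos_iff_pos_iff_pos (by simp [*]) nc, mul_pos_iff_pos_iff_pos na nb] at hpos
  exact odd_sum_ite_of_iff hpos

theorem card_filter_convexPos_erase_identity {Q : Finset (ℝ × ℝ)} [DecidablePred ConvexPos]
    (hgp : GenPos Q) (hQ : #Q = 5) :
    (32 * (if ConvexPos Q then 1 else 0) : ℤ) =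
      4 * (#{x ∈ Q | ConvexPos (Q.erase x)} : ℤ) ^ 2 -
        16 * #{x ∈ Q | ConvexPos (Q.erase x)} + 12 := by
  have hodd := odd_card_filter_convexPos_erase hgp hQ
  have hle : #{x ∈ Q | ConvexPos (Q.erase x)} ≤ 5 := hQ ▸ card_filter_le _ _
  have hfive : ConvexPos Q ↔ #{x ∈ Q | ConvexPos (Q.erase x)} = 5 := by
    rw [convexPos_iff_forall_erase hQ.ge, ← hQ, card_filter_eq_iff]
  rw [if_congr hfive rfl rfl]
  generalize #{x ∈ Q | ConvexPos (Q.erase x)} = c at *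
  interval_cases c <;> first | exact absurd hodd (by decide) | norm_num

/-- For any point placement `P` of `n ≥ 5` points,
`32·P₅(P) = 4·∑_T γ_T² − (3n − 8)·∑_T γ_T + 12·C(n,5)`. -/
theorem pentagon_gamma_identity (P : Finset (ℝ × ℝ)) (n : ℕ) (hgp : GenPos P)
    (hcard : P.card = n) (hn : 5 ≤ n) :
    (32 * convexPosCount P 5 : ℤ) =
      4 * ∑ T ∈ P.powersetCard 3, (gammaCount P T : ℤ) ^ 2 -
        (3 * (n : ℤ) - 8) * ∑ T ∈ P.powersetCard 3, (gammaCount P T : ℤ) +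
        12 * n.choose 5 := by
  classical
  subst hcard
  set 𝒜 := (P.powersetCard 4).filter ConvexPos with h𝒜
  have hsub : 𝒜 ⊆ P.powersetCard 4 := filter_subset _ _
  have hγ : ∀ T ∈ P.powersetCard 3, gammaCount P T = #{S ∈ 𝒜 | T ⊆ S} := by
    intro T hT
    obtain ⟨hTP, h3⟩ := mem_powersetCard.1 hT
    rw [h𝒜, ← card_filter_insert hTP h3]
    simp only [gammaCount, IsGammaPt]
    congr
  have hfive : (32 * convexPosCount P 5 : ℤ) = ∑ Q ∈ P.powersetCard 5,
      (4 * (#{S ∈ 𝒜 | S ⊆ Q} : ℤ) ^ 2 - 16 * #{S ∈ 𝒜 | S ⊆ Q} + 12) := by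
    have hcount : convexPosCount P 5 = ∑ Q ∈ P.powersetCard 5, if ConvexPos Q then 1 else 0 := by
      rw [← card_filter, convexPosCount]
    rw [hcount]
    push_cast
    rw [mul_sum]
    refine sum_congr rfl fun Q hQ => ?_
    obtain ⟨hQP, h5⟩ := mem_powersetCard.1 hQ
    rw [h𝒜, card_filter_erase hQP h5]
    exact card_filter_convexPos_erase_identity
      (fun x hx y hy z hz => hgp x (hQP hx) y (hQP hy) z (hQP hz)) h5
  have hsum (k : ℕ) : ∑ T ∈ P.powersetCard 3, (gammaCount P T : ℤ) ^ k =
      ∑ T ∈ P.powersetCard 3, (#{S ∈ 𝒜 | T ⊆ S} : ℤ) ^ k :=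
    sum_congr rfl fun T hT => by rw [hγ T hT]
  have hsum_one := hsum 1
  simp only [pow_one] at hsum_one
  rw [hfive, hsum, hsum_one,
    sum_sq_card_filter_subset_powersetCard P hsub,
    sum_card_filter_subset_powersetCard_three P hsub, sum_add_distrib, sum_sub_distrib,
    ← mul_sum, ← mul_sum, sum_card_filter_subset_powersetCard_five P hsub, sum_const,
    card_powersetCard, nsmul_eq_mul]
  ring
end

section
/- For any point placement P of n ≥ 5 points, 32·P₅(P) = 16·Σ_T β_T² − 16·Σ_T β_T + 8·(n − 4)·Σ_T γ_T − 128·C(n,5), where all sums range over all 3-element subsets T of P. -/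
open Finset

/-- Twice the signed area of the triangle `a b c`. -/
def orient (a b c : ℝ × ℝ) : ℝ :=
  (b.1 - a.1) * (c.2 - a.2) - (b.2 - a.2) * (c.1 - a.1)

theorem orient_rotate (a b c : ℝ × ℝ) : orient b c a = orient a b c := by
  unfold orient; ring

theorem orient_swap (a b c : ℝ × ℝ) : orient a c b = -orient a b c := by
  unfold orient; ring

theorem orient_add (a b c d : ℝ × ℝ) :
    orient a b c + orient a c d = orient a b d + orient b c d := by
  unfold orient; ring

theorem collinear_of_orient_eq_zero {a b c : ℝ × ℝ} (hab : a ≠ b) (h : orient a b c = 0) :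
    Collinear ℝ ({a, b, c} : Set (ℝ × ℝ)) := by
  rw [collinear_iff_of_mem (p₀ := a) (by simp)]
  refine ⟨b - a, ?_⟩
  unfold orient at h
  have key : ∃ r : ℝ, c = r • (b - a) +ᵥ a := by
    by_cases h1 : b.1 - a.1 = 0
    · have h2 : b.2 - a.2 ≠ 0 := fun h2 => hab (Prod.ext (by linarith) (by linarith))
      refine ⟨(c.2 - a.2) / (b.2 - a.2), Prod.ext ?_ ?_⟩
      · have : c.1 - a.1 = 0 := by
          rw [h1] at h
          have : (b.2 - a.2) * (c.1 - a.1) = 0 := by linarith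
          exact (mul_eq_zero.1 this).resolve_left h2
        simp [h1]; linarith
      · simp [h2]
    · refine ⟨(c.1 - a.1) / (b.1 - a.1), Prod.ext ?_ ?_⟩
      · simp [h1]
      · simp; field_simp; linarith
  rintro p (rfl | rfl | rfl)
  · exact ⟨0, by simp⟩
  · exact ⟨1, by simp⟩
  · exact key

theorem GenPos.orient_ne_zero {P : Finset (ℝ × ℝ)} (hP : GenPos P) {a b c : ℝ × ℝ}
    (ha : a ∈ P) (hb : b ∈ P) (hc : c ∈ P) (hab : a ≠ b) (hac : a ≠ c) (hbc : b ≠ c) :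
    orient a b c ≠ 0 := fun h =>
  hP a ha b hb c hc hab hac hbc (collinear_of_orient_eq_zero hab h)

theorem mem_convexHull_triple_iff {a b c x : ℝ × ℝ} (hc : orient a b x ≠ 0)
    (ha : orient b c x ≠ 0) (hb : orient c a x ≠ 0) :
    x ∈ convexHull ℝ ({a, b, c} : Set (ℝ × ℝ)) ↔
      (0 < orient a b x ↔ 0 < orient b c x) ∧ (0 < orient b c x ↔ 0 < orient c a x) := by
  constructor
  · intro h
    rw [convexHull_insert (by simp), convexHull_pair, mem_convexJoin] at h
    obtain ⟨p, rfl, q, ⟨s, t, hs, ht, hst, rfl⟩, u, v, hu, hv, huv, rfl⟩ := h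
    set D := orient p b c with hD
    have e1 : orient p b (u • p + v • (s • b + t • c)) = v * t * D := by
      obtain rfl : u = 1 - v := by linarith
      obtain rfl : s = 1 - t := by linarith
      simp only [hD, orient, Prod.fst_add, Prod.snd_add, Prod.smul_fst, Prod.smul_snd, smul_eq_mul]
      ring
    have e2 : orient b c (u • p + v • (s • b + t • c)) = u * D := by
      obtain rfl : u = 1 - v := by linarith
      obtain rfl : s = 1 - t := by linarith
      simp only [hD, orient, Prod.fst_add, Prod.snd_add, Prod.smul_fst, Prod.smul_snd, smul_eq_mul]
      ring
    have e3 : orient c p (u • p + v • (s • b + t • c)) = v * s * D := by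
      obtain rfl : u = 1 - v := by linarith
      obtain rfl : s = 1 - t := by linarith
      simp only [hD, orient, Prod.fst_add, Prod.snd_add, Prod.smul_fst, Prod.smul_snd, smul_eq_mul]
      ring
    rw [e1] at hc ⊢
    rw [e2] at ha ⊢
    rw [e3] at hb ⊢
    have p1 : 0 < v * t := lt_of_le_of_ne (by positivity) (left_ne_zero_of_mul hc).symm
    have p2 : 0 < u := lt_of_le_of_ne (by positivity) (left_ne_zero_of_mul ha).symm
    have p3 : 0 < v * s := lt_of_le_of_ne (by positivity) (left_ne_zero_of_mul hb).symm
    simp only [mul_pos_iff_of_pos_left p1, mul_pos_iff_of_pos_left p2,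
      mul_pos_iff_of_pos_left p3, and_self]
  · rintro ⟨h1, h2⟩
    set D := orient a b x + orient b c x + orient c a x with hD
    have hw : D ≠ 0 ∧ 0 ≤ orient b c x / D ∧ 0 ≤ orient c a x / D ∧ 0 ≤ orient a b x / D := by
      rcases lt_or_gt_of_ne ha with h | h
      · have h3 : orient a b x < 0 := lt_of_le_of_ne (not_lt.1 fun k => by linarith [h1.1 k]) hc
        have h4 : orient c a x < 0 := lt_of_le_of_ne (not_lt.1 fun k => by linarith [h2.2 k]) hb
        have h5 : D ≤ 0 := by linarith
        exact ⟨by linarith, div_nonneg_of_nonpos h.le h5, div_nonneg_of_nonpos h4.le h5,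
          div_nonneg_of_nonpos h3.le h5⟩
      · have h3 := h1.2 h
        have h4 := h2.1 h
        have h5 : 0 < D := by linarith
        exact ⟨h5.ne', by positivity, by positivity, by positivity⟩
    obtain ⟨hD0, w1, w2, w3⟩ := hw
    have hx : x = (orient b c x / D) • a + (orient c a x / D) • b + (orient a b x / D) • c := by
      refine Prod.ext ?_ ?_ <;>
      · simp only [Prod.fst_add, Prod.snd_add, Prod.smul_fst, Prod.smul_snd, smul_eq_mul]
        field_simp
        simp only [hD, orient]
        ring
    have hsum : orient b c x / D + orient c a x / D + orient a b x / D = 1 := by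
      field_simp; linarith
    rw [convexHull_insert (by simp), convexHull_pair, mem_convexJoin]
    by_cases h0 : orient c a x / D + orient a b x / D = 0
    · have : orient c a x / D = 0 := by linarith
      rw [div_eq_zero_iff] at this
      tauto
    · refine ⟨a, rfl, ((orient c a x / D) / (orient c a x / D + orient a b x / D)) • b +
        ((orient a b x / D) / (orient c a x / D + orient a b x / D)) • c,
        ⟨_, _, by positivity, by positivity,
          by rw [← add_div]; exact div_self h0, rfl⟩,
        orient b c x / D, orient c a x / D + orient a b x / D, by positivity, by positivity,
        by linarith, ?_⟩
      conv_rhs => rw [hx]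
      rw [smul_add, smul_smul, smul_smul, mul_div_cancel₀ _ h0, mul_div_cancel₀ _ h0, add_assoc]

theorem convexPos_iff (S : Finset (ℝ × ℝ)) :
    ConvexPos S ↔ ∀ x ∈ S, x ∉ convexHull ℝ ((S.erase x : Finset (ℝ × ℝ)) : Set (ℝ × ℝ)) := by
  refine forall₂_congr fun x hx => ⟨fun h hx' => ?_, fun h => ?_⟩
  · rw [(convex_convexHull ℝ _).mem_extremePoints_iff_mem_sdiff_convexHull_sdiff] at h
    refine h.2 (convexHull_mono ?_ hx')
    rw [coe_erase]
    exact Set.sdiff_subset_sdiff_left (subset_convexHull ℝ _)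
  · by_contra hne
    have hsub : (convexHull ℝ (S : Set (ℝ × ℝ))).extremePoints ℝ ⊆
        ((S.erase x : Finset (ℝ × ℝ)) : Set (ℝ × ℝ)) := fun y hy => by
      rw [coe_erase]
      exact ⟨extremePoints_convexHull_subset hy, fun hyx => hne (hyx ▸ hy)⟩
    have hcl := closure_convexHull_extremePoints
      (S.finite_toSet.isCompact_convexHull (𝕜 := ℝ)) (convex_convexHull ℝ _)
    have hxm : x ∈ convexHull ℝ (S : Set (ℝ × ℝ)) := subset_convexHull ℝ _ hx
    rw [← hcl] at hxm
    exact h (closure_minimal (convexHull_mono hsub)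
      ((finite_toSet _).isClosed_convexHull (𝕜 := ℝ)) hxm)

theorem convexPos_iff_erase {S : Finset (ℝ × ℝ)} (hS : 5 ≤ S.card) :
    ConvexPos S ↔ ∀ y ∈ S, ConvexPos (S.erase y) := by
  simp only [convexPos_iff]
  constructor
  · intro h y _ x hx hx'
    exact h x (mem_of_mem_erase hx)
      (convexHull_mono (coe_subset.2 (erase_subset_erase _ (erase_subset _ _))) hx')
  · intro h x hx hx'
    rw [convexHull_eq_union (𝕜 := ℝ)] at hx'
    simp only [Set.mem_iUnion, exists_prop] at hx'
    obtain ⟨t, ht, hind, hxt⟩ := hx'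
    have hcard : t.card ≤ 3 := by
      have h1 := hind.card_le_finrank_succ
      have h2 := Submodule.finrank_le (vectorSpan ℝ (Set.range ((↑) : t → ℝ × ℝ)))
      have h3 : Module.finrank ℝ (ℝ × ℝ) = 2 := by simp
      rw [Fintype.card_coe] at h1
      omega
    have ht' : t ⊆ S.erase x := coe_subset.1 ht
    have hlt : t.card < (S.erase x).card := by rw [card_erase_of_mem hx]; omega
    obtain ⟨y, hy, hyt⟩ := exists_mem_notMem_of_card_lt_card hlt
    rw [mem_erase] at hy
    refine h y hy.2 x (mem_erase.2 ⟨hy.1.symm, hx⟩) (convexHull_mono (coe_subset.2 ?_) hxt)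
    intro z hz
    have := mem_erase.1 (ht' hz)
    exact mem_erase.2 ⟨this.1, mem_erase.2 ⟨fun h => hyt (h ▸ hz), this.2⟩⟩

/-- Given the orientations of the triples of four points `0, 1, 2, 3`, decides whether the
point `i` lies in the triangle spanned by the others. -/
def inQuad (i : Fin 4) (s₀₁₂ s₀₁₃ s₀₂₃ s₁₂₃ : Bool) : Bool :=
  match i with
  | 0 => s₀₁₂ == s₀₂₃ && s₀₁₂ != s₀₁₃
  | 1 => s₁₂₃ == s₀₁₃ && s₁₂₃ != s₀₁₂
  | 2 => s₀₁₂ == s₀₂₃ && s₀₁₂ != s₁₂₃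
  | 3 => s₀₁₃ == s₁₂₃ && s₀₁₃ != s₀₂₃

/-- The orientations of the triples of four points satisfy the sign condition
imposed by `orient_add`. -/
def quadSign (s₀₁₂ s₀₁₃ s₀₂₃ s₁₂₃ : Bool) : Bool :=
  !(s₀₁₂ == s₀₂₃ && s₀₁₃ == s₁₂₃ && s₀₁₂ != s₀₁₃)

/-- The sign condition imposed by a relation `a * b + e * f = c * d`. -/
def pluckerSign (a b c d e f : Bool) : Bool :=
  !((a == b) == (e == f) && (a == b) != (c == d))

theorem quadSign_orient {p q r s : ℝ} (hp : p ≠ 0) (hq : q ≠ 0) (hr : r ≠ 0) (hs : s ≠ 0)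
    (h : p + r = q + s) :
    quadSign (decide (0 < p)) (decide (0 < q)) (decide (0 < r)) (decide (0 < s)) = true := by
  rcases lt_or_gt_of_ne hp with hp | hp <;> rcases lt_or_gt_of_ne hq with hq | hq <;>
  rcases lt_or_gt_of_ne hr with hr | hr <;> rcases lt_or_gt_of_ne hs with hs | hs <;>
  first
  | (exfalso; linarith)
  | simp [quadSign, hp, hq, hr, hs, not_lt_of_gt]

theorem decide_pos_beq {a b : ℝ} (ha : a ≠ 0) (hb : b ≠ 0) :
    (decide (0 < a) == decide (0 < b)) = decide (0 < a * b) := by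
  rcases lt_or_gt_of_ne ha with ha | ha <;> rcases lt_or_gt_of_ne hb with hb | hb
  · simp [ha.not_gt, hb.not_gt, mul_pos_of_neg_of_neg ha hb]
  · simp [ha.not_gt, hb, (mul_neg_of_neg_of_pos ha hb).not_gt]
  · simp [ha, hb.not_gt, (mul_neg_of_pos_of_neg ha hb).not_gt]
  · simp [ha, hb]

theorem pluckerSign_of_eq {a b c d e f : ℝ} (ha : a ≠ 0) (hb : b ≠ 0) (hc : c ≠ 0) (hd : d ≠ 0)
    (he : e ≠ 0) (hf : f ≠ 0) (h : a * b + e * f = c * d) :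
    pluckerSign (decide (0 < a)) (decide (0 < b)) (decide (0 < c)) (decide (0 < d))
      (decide (0 < e)) (decide (0 < f)) = true := by
  unfold pluckerSign
  rw [decide_pos_beq ha hb, decide_pos_beq hc hd, decide_pos_beq he hf]
  have h1 := mul_ne_zero ha hb
  have h2 := mul_ne_zero hc hd
  have h3 := mul_ne_zero he hf
  rcases lt_or_gt_of_ne h1 with k1 | k1 <;> rcases lt_or_gt_of_ne h2 with k2 | k2 <;>
  rcases lt_or_gt_of_ne h3 with k3 | k3 <;>
  first
  | (exfalso; linarith)
  | simp only [k1, k2, k3, k1.not_gt, k2.not_gt, k3.not_gt, decide_true, decide_false]; rfl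

theorem mem_convexHull_iff_inQuad (g : Fin 4 → ℝ × ℝ)
    (hg : ∀ i j k, i ≠ j → i ≠ k → j ≠ k → orient (g i) (g j) (g k) ≠ 0) (i : Fin 4) :
    g i ∈ convexHull ℝ (g '' {k | k ≠ i}) ↔
      inQuad i (decide (0 < orient (g 0) (g 1) (g 2))) (decide (0 < orient (g 0) (g 1) (g 3)))
        (decide (0 < orient (g 0) (g 2) (g 3))) (decide (0 < orient (g 1) (g 2) (g 3))) = true := by
  have h012 := hg 0 1 2 (by decide) (by decide) (by decide)
  have h013 := hg 0 1 3 (by decide) (by decide) (by decide)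
  have h023 := hg 0 2 3 (by decide) (by decide) (by decide)
  have h123 := hg 1 2 3 (by decide) (by decide) (by decide)
  have key : ∀ i a b c : Fin 4, {k | k ≠ i} = ({a, b, c} : Set (Fin 4)) → i ≠ a → i ≠ b → i ≠ c →
      a ≠ b → a ≠ c → b ≠ c → (g i ∈ convexHull ℝ (g '' {k | k ≠ i}) ↔
      (0 < orient (g a) (g b) (g i) ↔ 0 < orient (g b) (g c) (g i)) ∧
        (0 < orient (g b) (g c) (g i) ↔ 0 < orient (g c) (g a) (g i))) := by
    intro i a b c h ha hb hc hab hac hbc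
    rw [h, Set.image_insert_eq, Set.image_pair]
    exact mem_convexHull_triple_iff (hg _ _ _ hab ha.symm hb.symm) (hg _ _ _ hbc hb.symm hc.symm)
      (hg _ _ _ hac.symm hc.symm ha.symm)
  have e0 := key 0 1 2 3 (by ext k; fin_cases k <;> simp) (by decide) (by decide) (by decide)
    (by decide) (by decide) (by decide)
  have e1 := key 1 0 2 3 (by ext k; fin_cases k <;> simp) (by decide) (by decide) (by decide)
    (by decide) (by decide) (by decide)
  have e2 := key 2 0 1 3 (by ext k; fin_cases k <;> simp) (by decide) (by decide) (by decide)
    (by decide) (by decide) (by decide)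
  have e3 := key 3 0 1 2 (by ext k; fin_cases k <;> simp) (by decide) (by decide) (by decide)
    (by decide) (by decide) (by decide)
  have neg : ∀ {r : ℝ}, r ≠ 0 → (0 < -r ↔ ¬ 0 < r) := fun h =>
    ⟨fun h1 h2 => by linarith, fun h1 => neg_pos.2 (lt_of_le_of_ne (not_lt.1 h1) h)⟩
  rw [orient_rotate (g 0) (g 1), orient_rotate (g 0) (g 2), orient_rotate (g 0) (g 3),
    orient_swap (g 0) (g 1), neg h013] at e0
  rw [orient_swap (g 0) (g 1), orient_rotate (g 1) (g 2),
    ← orient_rotate (g 3) (g 0), neg h012] at e1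
  rw [orient_swap (g 1) (g 2), ← orient_rotate (g 3) (g 0), neg h123] at e2
  rw [← orient_rotate (g 2) (g 0), orient_swap (g 0) (g 2), neg h023] at e3
  clear key neg hg
  by_cases k012 : 0 < orient (g 0) (g 1) (g 2) <;> by_cases k013 : 0 < orient (g 0) (g 1) (g 3) <;>
  by_cases k023 : 0 < orient (g 0) (g 2) (g 3) <;> by_cases k123 : 0 < orient (g 1) (g 2) (g 3) <;>
  simp only [k012, k013, k023, k123] at e0 e1 e2 e3 ⊢ <;> fin_cases i <;>
  first
  | exact e0.trans (by decide)
  | exact e1.trans (by decide)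
  | exact e2.trans (by decide)
  | exact e3.trans (by decide)

/-- Whether four points with the given orientations are in convex position. -/
def quadConvex (s₀₁₂ s₀₁₃ s₀₂₃ s₁₂₃ : Bool) : Bool :=
  !inQuad 0 s₀₁₂ s₀₁₃ s₀₂₃ s₁₂₃ && !inQuad 1 s₀₁₂ s₀₁₃ s₀₂₃ s₁₂₃ &&
    !inQuad 2 s₀₁₂ s₀₁₃ s₀₂₃ s₁₂₃ && !inQuad 3 s₀₁₂ s₀₁₃ s₀₂₃ s₁₂₃

/-- If the sign conditions on five points hold and `w i j` tells whether the point `i` lies in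
the triangle left by removing `i` and `j`, then the number of pairs that are β-points of the
complementary triangle, plus the number of convex quadrilaterals, is four or five. -/
theorem sum_pairs_of_signs (σ : Fin 5 → Fin 5 → Fin 5 → Bool) (w : Fin 5 → Fin 5 → Bool)
    (hw : ∀ (j : Fin 5) (i : Fin 4), w (j.succAbove i) j = inQuad i
      (σ (j.succAbove 0) (j.succAbove 1) (j.succAbove 2))
      (σ (j.succAbove 0) (j.succAbove 1) (j.succAbove 3))
      (σ (j.succAbove 0) (j.succAbove 2) (j.succAbove 3))
      (σ (j.succAbove 1) (j.succAbove 2) (j.succAbove 3)))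
    (hq : ∀ j : Fin 5, quadSign
      (σ (j.succAbove 0) (j.succAbove 1) (j.succAbove 2))
      (σ (j.succAbove 0) (j.succAbove 1) (j.succAbove 3))
      (σ (j.succAbove 0) (j.succAbove 2) (j.succAbove 3))
      (σ (j.succAbove 1) (j.succAbove 2) (j.succAbove 3)) = true)
    (h₀ : pluckerSign (σ 0 1 2) (σ 0 3 4) (σ 0 1 3) (σ 0 2 4) (σ 0 1 4) (σ 0 2 3) = true)
    (h₁ : pluckerSign (σ 0 1 2) (σ 1 3 4) (σ 0 1 3) (σ 1 2 4) (σ 0 1 4) (σ 1 2 3) = true)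
    (h₂ : pluckerSign (σ 0 1 2) (σ 2 3 4) (σ 0 2 3) (σ 1 2 4) (σ 0 2 4) (σ 1 2 3) = true)
    (h₃ : pluckerSign (σ 0 1 3) (σ 2 3 4) (σ 0 2 3) (σ 1 3 4) (σ 0 3 4) (σ 1 2 3) = true)
    (h₄ : pluckerSign (σ 0 1 4) (σ 2 3 4) (σ 0 2 4) (σ 1 3 4) (σ 0 3 4) (σ 1 2 4) = true)
    (c : Fin 5 → Bool) (hc : ∀ j, c j = decide (∀ i, w (j.succAbove i) j = false)) :
    ∑ i, ∑ j ∈ univ.erase i,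
      (16 * (!c j && !w i j && (!c i && !w j i)).toNat + 8 * (c j).toNat) =
        32 * (decide (∀ j, c j = true)).toNat + 128 := by
  have e : univ.erase (0 : Fin 5) = {1, 2, 3, 4} ∧ univ.erase (1 : Fin 5) = {0, 2, 3, 4} ∧
      univ.erase (2 : Fin 5) = {0, 1, 3, 4} ∧ univ.erase (3 : Fin 5) = {0, 1, 2, 4} ∧
      univ.erase (4 : Fin 5) = {0, 1, 2, 3} := by decide
  have hc' : ∀ j, c j = quadConvex
      (σ (j.succAbove 0) (j.succAbove 1) (j.succAbove 2))
      (σ (j.succAbove 0) (j.succAbove 1) (j.succAbove 3))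
      (σ (j.succAbove 0) (j.succAbove 2) (j.succAbove 3))
      (σ (j.succAbove 1) (j.succAbove 2) (j.succAbove 3)) := by
    intro j
    rw [hc j, Bool.eq_iff_iff]
    simp only [hw, Fin.forall_fin_succ, quadConvex, IsEmpty.forall_iff, decide_eq_true_eq,
      Bool.and_eq_true, Bool.not_eq_true', and_assoc, and_true]
    rfl
  have hall : decide (∀ j, c j = true) = (c 0 && c 1 && c 2 && c 3 && c 4) := by
    rw [Bool.eq_iff_iff]
    simp only [Fin.forall_fin_succ, IsEmpty.forall_iff, decide_eq_true_eq,
      Bool.and_eq_true, and_assoc, and_true]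
    rfl
  rw [hall]
  clear hall hc
  rw [Fin.sum_univ_five, e.1, e.2.1, e.2.2.1, e.2.2.2.1, e.2.2.2.2]
  clear e
  simp only [sum_insert, sum_singleton, mem_insert, mem_singleton, Fin.reduceEq, or_self,
    not_false_eq_true]
  have w0 := hw 0; have w1 := hw 1; have w2 := hw 2; have w3 := hw 3; have w4 := hw 4
  have q0 := hq 0; have q1 := hq 1; have q2 := hq 2; have q3 := hq 3; have q4 := hq 4
  have c0 := hc' 0; have c1 := hc' 1; have c2 := hc' 2; have c3 := hc' 3; have c4 := hc' 4
  clear hw hq hc'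
  simp only [Fin.forall_fin_succ, IsEmpty.forall_iff, and_true] at w0 w1 w2 w3 w4
  simp [Fin.succAbove, Fin.lt_def] at w0 w1 w2 w3 w4 q0 q1 q2 q3 q4 c0 c1 c2 c3 c4
  simp only [w0, w1, w2, w3, w4, c0, c1, c2, c3, c4]
  clear w0 w1 w2 w3 w4 c0 c1 c2 c3 c4
  revert h₀ h₁ h₂ h₃ h₄ q0 q1 q2 q3 q4
  generalize σ 0 1 2 = s₀₁₂, σ 0 1 3 = s₀₁₃, σ 0 1 4 = s₀₁₄, σ 0 2 3 = s₀₂₃,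
    σ 0 2 4 = s₀₂₄, σ 0 3 4 = s₀₃₄, σ 1 2 3 = s₁₂₃, σ 1 2 4 = s₁₂₄, σ 1 3 4 = s₁₃₄,
    σ 2 3 4 = s₂₃₄
  clear w c σ
  revert s₀₁₂ s₀₁₃ s₀₁₄ s₀₂₃ s₀₂₄ s₀₃₄ s₁₂₃ s₁₂₄ s₁₃₄ s₂₃₄
  decide +kernel

/-- If `w i j` tells whether `f i` lies in the triangle left by removing `f i` and `f j` from
five points in general position, then the pairs that are β-points of the complementary triangle
and the convex quadrilaterals determine whether the five points are in convex position. -/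
theorem sum_pairs_of_points (f : Fin 5 → ℝ × ℝ)
    (hf : ∀ i j k, i ≠ j → i ≠ k → j ≠ k → orient (f i) (f j) (f k) ≠ 0)
    (w : Fin 5 → Fin 5 → Bool)
    (hw : ∀ i j, w i j = true ↔ f i ∈ convexHull ℝ (f '' {k | k ≠ i ∧ k ≠ j}))
    (c : Fin 5 → Bool) (hc : ∀ j, c j = decide (∀ i, w (j.succAbove i) j = false)) :
    ∑ i, ∑ j ∈ univ.erase i,
      (16 * (!c j && !w i j && (!c i && !w j i)).toNat + 8 * (c j).toNat) =
        32 * (decide (∀ j, c j = true)).toNat + 128 := by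
  have hs : ∀ (j : Fin 5) (a b d : Fin 4), a ≠ b → a ≠ d → b ≠ d →
      orient (f (j.succAbove a)) (f (j.succAbove b)) (f (j.succAbove d)) ≠ 0 :=
    fun j a b d h1 h2 h3 => hf _ _ _ (by simpa using h1) (by simpa using h2) (by simpa using h3)
  refine sum_pairs_of_signs (fun i j k => decide (0 < orient (f i) (f j) (f k))) w
    (fun j i => ?_) (fun j => ?_) ?_ ?_ ?_ ?_ ?_ c hc
  · rw [Bool.eq_iff_iff, ← mem_convexHull_iff_inQuad (fun i => f (j.succAbove i)) (hs j) i, hw]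
    have : f '' {k | k ≠ j.succAbove i ∧ k ≠ j} =
        (fun i => f (j.succAbove i)) '' {k | k ≠ i} := by
      ext p
      constructor
      · rintro ⟨k, ⟨h1, h2⟩, rfl⟩
        obtain ⟨l, rfl⟩ := Fin.exists_succAbove_eq h2
        exact ⟨l, fun h => h1 (h ▸ rfl), rfl⟩
      · rintro ⟨l, h, rfl⟩
        exact ⟨_, ⟨by simpa using h, Fin.succAbove_ne j l⟩, rfl⟩
    rw [this]
  · exact quadSign_orient (hs j _ _ _ (by decide) (by decide) (by decide))
      (hs j _ _ _ (by decide) (by decide) (by decide))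
      (hs j _ _ _ (by decide) (by decide) (by decide))
      (hs j _ _ _ (by decide) (by decide) (by decide)) (orient_add _ _ _ _)
  all_goals
    refine pluckerSign_of_eq (hf _ _ _ ?_ ?_ ?_) (hf _ _ _ ?_ ?_ ?_) (hf _ _ _ ?_ ?_ ?_)
      (hf _ _ _ ?_ ?_ ?_) (hf _ _ _ ?_ ?_ ?_) (hf _ _ _ ?_ ?_ ?_) ?_
    any_goals decide
    simp only [orient]
    ring

open scoped Classical in
/-- The contribution of a triangle `T` and an ordered pair of points to the right-hand side. -/
noncomputable def pairWeight (T : Finset (ℝ × ℝ)) (x y : ℝ × ℝ) : ℕ :=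
  16 * (decide (IsBetaPt T x ∧ IsBetaPt T y)).toNat + 8 * (decide (IsGammaPt T x)).toNat

open scoped Classical in
theorem sum_pairWeight_of_card_eq_five {F : Finset (ℝ × ℝ)} (hF : GenPos F) (h5 : F.card = 5) :
    ∑ x ∈ F, ∑ y ∈ F.erase x, pairWeight ((F.erase x).erase y) x y =
      32 * (decide (ConvexPos F)).toNat + 128 := by
  let f : Fin 5 ↪ ℝ × ℝ := (F.equivFinOfCardEq h5).symm.toEmbedding.trans (.subtype _)
  have hfF : univ.map f = F := by
    ext x
    simp only [mem_map, mem_univ, true_and]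
    constructor
    · rintro ⟨i, rfl⟩
      exact ((F.equivFinOfCardEq h5).symm i).2
    · intro hx
      exact ⟨F.equivFinOfCardEq h5 ⟨x, hx⟩, by simp [f]⟩
  have hmem : ∀ i, f i ∈ F := fun i => hfF ▸ mem_map_of_mem f (mem_univ i)
  have hne : ∀ {i j}, i ≠ j → f i ≠ f j := fun h => f.injective.ne h
  have hforall : ∀ p : ℝ × ℝ → Prop, (∀ x ∈ F, p x) ↔ ∀ i, p (f i) := fun p => by
    rw [← hfF]; simp
  have himage : ∀ i j, (((F.erase (f j)).erase (f i) : Finset _) : Set (ℝ × ℝ)) =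
      f '' {k | k ≠ i ∧ k ≠ j} := fun i j => by
    rw [← hfF, ← map_erase, ← map_erase]
    ext x
    simp only [coe_map, coe_erase, coe_univ, Set.mem_image, Set.mem_sdiff, Set.mem_univ,
      Set.mem_singleton_iff, true_and, Set.mem_ofPred_eq]
    tauto
  let w : Fin 5 → Fin 5 → Bool := fun i j =>
    decide (f i ∈ convexHull ℝ (f '' {k | k ≠ i ∧ k ≠ j}))
  let c : Fin 5 → Bool := fun j => decide (∀ i, w (j.succAbove i) j = false)
  have hc : ∀ j, ConvexPos (F.erase (f j)) ↔ c j = true := by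
    intro j
    simp only [convexPos_iff, c, w, decide_eq_true_eq, decide_eq_false_iff_not]
    constructor
    · intro h i
      rw [← himage]
      exact h _ (mem_erase.2 ⟨hne (Fin.succAbove_ne j i), hmem _⟩)
    · intro h x hx
      rw [mem_erase, ← hfF, mem_map] at hx
      obtain ⟨hxj, i, -, rfl⟩ := hx
      obtain ⟨l, rfl⟩ := Fin.exists_succAbove_eq (fun e : i = j => hxj (e ▸ rfl))
      rw [himage]
      exact h l
  have key := sum_pairs_of_points f
    (fun i j k h1 h2 h3 => hF.orient_ne_zero (hmem i) (hmem j) (hmem k) (hne h1) (hne h2) (hne h3))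
    w (fun i j => by simp [w]) c (fun j => rfl)
  have hconv : decide (ConvexPos F) = decide (∀ j, c j = true) := by
    rw [decide_eq_decide, convexPos_iff_erase h5.ge, hforall]
    exact forall_congr' hc
  rw [hconv, ← key]
  have hins : ∀ i j, i ≠ j → insert (f i) ((F.erase (f i)).erase (f j)) = F.erase (f j) :=
    fun i j hij => by
      rw [erase_right_comm, insert_erase (mem_erase.2 ⟨hne hij, hmem i⟩)]
  have hbeta : ∀ i j, i ≠ j → (IsBetaPt ((F.erase (f i)).erase (f j)) (f i) ↔
      (!c j && !w i j) = true) := fun i j hij => by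
    rw [IsBetaPt, hins i j hij, hc, erase_right_comm, himage]
    simp [w]
  conv_lhs => rw [← hfF, sum_map]
  refine sum_congr rfl fun i _ => ?_
  rw [← map_erase, sum_map, map_erase, hfF]
  refine sum_congr rfl fun j hj => ?_
  have hij : i ≠ j := (ne_of_mem_erase hj).symm
  have h1 : decide (IsBetaPt ((F.erase (f i)).erase (f j)) (f i) ∧
      IsBetaPt ((F.erase (f i)).erase (f j)) (f j)) = (!c j && !w i j && (!c i && !w j i)) := by
    rw [Bool.eq_iff_iff, decide_eq_true_eq, hbeta i j hij, erase_right_comm, hbeta j i hij.symm,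
      ← Bool.and_eq_true]
  have h2 : decide (IsGammaPt ((F.erase (f i)).erase (f j)) (f i)) = c j := by
    rw [Bool.eq_iff_iff, decide_eq_true_eq, IsGammaPt, hins i j hij, hc]
  rw [pairWeight, h1, h2]

/-- Choosing a `k`-subset and then an ordered pair outside it amounts to choosing a
`k + 2`-subset and then an ordered pair inside it. -/
theorem sum_powersetCard_pairs {α M : Type*} [DecidableEq α] [AddCommMonoid M] (P : Finset α)
    (k : ℕ) (g : Finset α → α → α → M) :
    ∑ T ∈ P.powersetCard k, ∑ x ∈ P \ T, ∑ y ∈ (P \ T).erase x, g T x y =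
      ∑ F ∈ P.powersetCard (k + 2), ∑ x ∈ F, ∑ y ∈ F.erase x, g ((F.erase x).erase y) x y := by
  simp only [sum_sigma']
  refine sum_bij' (fun p _ => ⟨insert p.2.1 (insert p.2.2 p.1), p.2.1, p.2.2⟩)
    (fun p _ => ⟨(p.1.erase p.2.1).erase p.2.2, p.2.1, p.2.2⟩) ?_ ?_ ?_ ?_ ?_
  · rintro ⟨T, x, y⟩ h
    simp only [mem_sigma, mem_powersetCard, mem_sdiff, mem_erase] at h
    obtain ⟨⟨hT, hk⟩, ⟨hx, hxT⟩, hyx, hy, hyT⟩ := h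
    simp only [mem_sigma, mem_powersetCard, mem_erase]
    refine ⟨⟨by grind, ?_⟩, by simp, hyx, by simp⟩
    rw [card_insert_of_notMem (by simp [hxT, hyx.symm]), card_insert_of_notMem hyT, hk]
  · rintro ⟨F, x, y⟩ h
    simp only [mem_sigma, mem_powersetCard, mem_erase] at h
    obtain ⟨⟨hF, hk⟩, hx, hyx, hy⟩ := h
    simp only [mem_sigma, mem_powersetCard, mem_sdiff, mem_erase]
    refine ⟨⟨by grind, ?_⟩, ⟨hF hx, by simp⟩, hyx, hF hy, by simp⟩
    rw [card_erase_of_mem (mem_erase.2 ⟨hyx, hy⟩), card_erase_of_mem hx, hk]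
    omega
  · rintro ⟨T, x, y⟩ h
    simp only [mem_sigma, mem_powersetCard, mem_sdiff, mem_erase] at h
    have : ((insert x (insert y T)).erase x).erase y = T := by grind
    simp only [this]
  · rintro ⟨F, x, y⟩ h
    simp only [mem_sigma, mem_powersetCard, mem_erase] at h
    have : insert x (insert y ((F.erase x).erase y)) = F := by grind
    simp [this]
  · rintro ⟨T, x, y⟩ h
    simp only [mem_sigma, mem_powersetCard, mem_sdiff, mem_erase] at h
    have : ((insert x (insert y T)).erase x).erase y = T := by grind
    simp only [this]

theorem sum_pairWeight_sdiff {P T : Finset (ℝ × ℝ)} (hT : T ∈ P.powersetCard 3) :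
    ((∑ x ∈ P \ T, ∑ y ∈ (P \ T).erase x, pairWeight T x y : ℕ) : ℤ) =
      16 * ((betaCount P T : ℤ) ^ 2 - betaCount P T) +
        8 * ((P.card : ℤ) - 4) * gammaCount P T := by
  classical
  rw [mem_powersetCard] at hT
  have hβ : (betaCount P T : ℤ) = ∑ x ∈ P \ T, if IsBetaPt T x then 1 else 0 := by
    rw [betaCount, card_filter]; push_cast; rfl
  have hγ : (gammaCount P T : ℤ) = ∑ x ∈ P \ T, if IsGammaPt T x then 1 else 0 := by
    rw [gammaCount, card_filter]; push_cast; rfl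
  have hcard : (((P \ T).card : ℕ) : ℤ) = P.card - 3 := by
    have := card_sdiff_add_card_eq_card hT.1
    omega
  have hrow : ∀ x ∈ P \ T, ((∑ y ∈ (P \ T).erase x, pairWeight T x y : ℕ) : ℤ) =
      16 * ((if IsBetaPt T x then 1 else 0) * betaCount P T - if IsBetaPt T x then 1 else 0) +
        8 * ((P.card : ℤ) - 4) * if IsGammaPt T x then 1 else 0 := by
    intro x hx
    have hsplit := add_sum_erase (P \ T) (fun y => (pairWeight T x y : ℤ)) hx
    have hw : ∀ y, (pairWeight T x y : ℤ) = 16 * ((if IsBetaPt T x then 1 else 0) *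
        (if IsBetaPt T y then 1 else 0)) + 8 * if IsGammaPt T x then 1 else 0 := by
      intro y
      by_cases h1 : IsBetaPt T x <;> by_cases h2 : IsBetaPt T y <;>
        by_cases h3 : IsGammaPt T x <;> simp [pairWeight, h1, h2, h3]
    push_cast
    simp only [hw, sum_add_distrib, ← mul_sum, ← hβ, sum_const, nsmul_eq_mul, hcard] at hsplit ⊢
    have hsq : (if IsBetaPt T x then (1 : ℤ) else 0) * (if IsBetaPt T x then 1 else 0) =
      if IsBetaPt T x then 1 else 0 := by split_ifs <;> rfl
    rw [hsq] at hsplit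
    linarith
  push_cast at hrow ⊢
  rw [sum_congr rfl hrow, sum_add_distrib, ← mul_sum, ← mul_sum, sum_sub_distrib, ← sum_mul,
    ← hβ, ← hγ]
  ring

/-- For any point placement `P` of `n ≥ 5` points,
`32·P₅(P) = 16·∑_T β_T² − 16·∑_T β_T + 8·(n − 4)·∑_T γ_T − 128·C(n,5)`. -/
theorem pentagon_beta_identity (P : Finset (ℝ × ℝ)) (n : ℕ) (hgp : GenPos P)
    (hcard : P.card = n) (hn : 5 ≤ n) :
    (32 * convexPosCount P 5 : ℤ) =
      16 * ∑ T ∈ P.powersetCard 3, (betaCount P T : ℤ) ^ 2 -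
        16 * ∑ T ∈ P.powersetCard 3, (betaCount P T : ℤ) +
        8 * ((n : ℤ) - 4) * ∑ T ∈ P.powersetCard 3, (gammaCount P T : ℤ) -
        128 * n.choose 5 := by
  classical
  subst hcard
  have hF : ∀ F ∈ P.powersetCard 5, ∑ x ∈ F, ∑ y ∈ F.erase x, pairWeight ((F.erase x).erase y) x y =
      32 * (decide (ConvexPos F)).toNat + 128 := fun F h => by
    rw [mem_powersetCard] at h
    exact sum_pairWeight_of_card_eq_five
      (fun x hx y hy z hz => hgp x (h.1 hx) y (h.1 hy) z (h.1 hz)) h.2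
  have hconv : ∑ F ∈ P.powersetCard 5, (decide (ConvexPos F)).toNat = convexPosCount P 5 := by
    rw [convexPosCount, card_filter]
    refine sum_congr rfl fun F _ => ?_
    by_cases h : ConvexPos F <;> simp [h]
  have key := sum_powersetCard_pairs P 3 pairWeight
  rw [sum_congr rfl hF, sum_add_distrib, ← mul_sum, hconv, sum_const, card_powersetCard,
    smul_eq_mul] at key
  have key' := congrArg (Nat.cast : ℕ → ℤ) key
  rw [Nat.cast_sum, sum_congr rfl fun T hT => sum_pairWeight_sdiff hT, sum_add_distrib, ← mul_sum,
    ← mul_sum, sum_sub_distrib] at key'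
  push_cast at key'
  linarith
end

section
/- Let S ⊆ ℝ² be a set of 5 points in general position. Then the number of 4-element subsets of S that are in convex position equals 5 if the convex hull of S has 5 extreme points, equals 3 if it has 4 extreme points, and equals 1 if it has 3 extreme points. -/
open Finset

/-- A point of a finite set is extreme in the convex hull exactly when it is not in the convex hull
of the other points. -/
theorem mem_extremePoints_convexHull_iff {s : Finset (ℝ × ℝ)} {x : ℝ × ℝ} (hx : x ∈ s) :
    x ∈ Set.extremePoints ℝ (convexHull ℝ (s : Set (ℝ × ℝ))) ↔
      x ∉ convexHull ℝ ((s.erase x : Finset (ℝ × ℝ)) : Set (ℝ × ℝ)) := by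
  rw [coe_erase]
  constructor
  · intro h hmem
    rw [(convex_convexHull ℝ _).mem_extremePoints_iff_mem_sdiff_convexHull_sdiff] at h
    exact h.2 (convexHull_mono (Set.sdiff_subset_sdiff_left (subset_convexHull ℝ _)) hmem)
  · intro h
    by_contra hext
    have hsub : (convexHull ℝ (s : Set (ℝ × ℝ))).extremePoints ℝ ⊆ (s : Set (ℝ × ℝ)) \ {x} :=
      fun y hy => ⟨extremePoints_convexHull_subset hy, fun hyx => hext (hyx ▸ hy)⟩
    have hfin := s.finite_toSet
    have hkm := closure_convexHull_extremePoints (hfin.isCompact_convexHull ℝ)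
      (convex_convexHull ℝ (s : Set (ℝ × ℝ)))
    rw [((hfin.subset extremePoints_convexHull_subset).isClosed_convexHull ℝ).closure_eq] at hkm
    exact h (convexHull_mono hsub (hkm.ge (subset_convexHull ℝ _ hx)))

/-- The linear space of affine dependencies among five points of the plane. -/
noncomputable def affineDependencies (p : Fin 5 → ℝ × ℝ) : Submodule ℝ (Fin 5 → ℝ) :=
  LinearMap.ker (Fintype.linearCombination ℝ fun i => ((1 : ℝ), p i))

theorem mem_affineDependencies {p : Fin 5 → ℝ × ℝ} {w : Fin 5 → ℝ} :
    w ∈ affineDependencies p ↔ ∑ i, w i = 0 ∧ ∑ i, w i • p i = 0 := by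
  simp [affineDependencies, Fintype.linearCombination_apply, Prod.ext_iff, Prod.fst_sum,
    Prod.snd_sum]

theorem comp_mem_affineDependencies {p : Fin 5 → ℝ × ℝ} {w : Fin 5 → ℝ}
    (σ : Equiv.Perm (Fin 5)) (hw : w ∈ affineDependencies p) :
    w ∘ σ ∈ affineDependencies (p ∘ σ) := by
  obtain ⟨h0, h1⟩ := mem_affineDependencies.1 hw
  exact mem_affineDependencies.2
    ⟨(Equiv.sum_comp σ w).trans h0, (Equiv.sum_comp σ fun i => w i • p i).trans h1⟩

theorem not_collinear_of_genPos {p : Fin 5 → ℝ × ℝ} (hgp : GenPos (univ.image p))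
    (hinj : Function.Injective p) (i j k : Fin 5) (hij : i ≠ j) (hik : i ≠ k) (hjk : j ≠ k) :
    ¬ Collinear ℝ ({p i, p j, p k} : Set (ℝ × ℝ)) :=
  hgp _ (mem_image_of_mem p (mem_univ i)) _ (mem_image_of_mem p (mem_univ j)) _
    (mem_image_of_mem p (mem_univ k)) (hinj.ne hij) (hinj.ne hik) (hinj.ne hjk)

theorem one_lt_finrank_affineDependencies (p : Fin 5 → ℝ × ℝ) :
    1 < Module.finrank ℝ (affineDependencies p) := by
  have hadd := LinearMap.finrank_range_add_finrank_ker
    (Fintype.linearCombination ℝ fun i => ((1 : ℝ), p i))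
  have hle := Submodule.finrank_le
    (LinearMap.range (Fintype.linearCombination ℝ fun i => ((1 : ℝ), p i)))
  simp only [Module.finrank_prod, Module.finrank_self, Module.finrank_fin_fun] at hadd hle
  unfold affineDependencies
  omega

theorem exists_univ_eq_insert_of_ne {m x : Fin 5} (h : m ≠ x) :
    ∃ i j k, i ≠ j ∧ i ≠ k ∧ j ≠ k ∧ (univ : Finset (Fin 5)) = {m, x, i, j, k} := by
  decide +revert

/-- An affine dependency among points in general position that omits two of five points is
trivial. -/
theorem eq_zero_of_mem_affineDependencies {p : Fin 5 → ℝ × ℝ}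
    (hp : ∀ i j k, i ≠ j → i ≠ k → j ≠ k → ¬ Collinear ℝ ({p i, p j, p k} : Set (ℝ × ℝ)))
    {w : Fin 5 → ℝ} (hw : w ∈ affineDependencies p) {m x : Fin 5} (hmx : m ≠ x)
    (hm : w m = 0) (hx : w x = 0) : w = 0 := by
  obtain ⟨i, j, k, hij, hik, hjk, huniv⟩ := exists_univ_eq_insert_of_ne hmx
  have hcases : ∀ y, y = m ∨ y = x ∨ y = i ∨ y = j ∨ y = k := fun y => by
    simpa [huniv] using mem_univ y
  obtain ⟨h0, h1⟩ := mem_affineDependencies.1 hw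
  have hsupp : ∀ y ∈ (univ : Finset (Fin 5)), y ∉ ({i, j, k} : Finset (Fin 5)) → w y = 0 := by
    intro y _ hy
    rcases hcases y with rfl | rfl | h
    · exact hm
    · exact hx
    · exact absurd (by simpa using h) hy
  rw [← sum_subset (subset_univ {i, j, k}) hsupp] at h0
  rw [← sum_subset (subset_univ {i, j, k}) fun y hy hy' => by simp [hsupp y hy hy']] at h1
  have hind := affineIndependent_iff_not_collinear_set.2 (hp i j k hij hik hjk)
  rw [affineIndependent_iff] at hind
  have hzero := hind univ ![w i, w j, w k]
    (by simpa [Fin.sum_univ_three, hij, hik, hjk, add_assoc] using h0)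
    (by simpa [Fin.sum_univ_three, hij, hik, hjk, add_assoc] using h1)
  funext y
  rcases hcases y with rfl | rfl | rfl | rfl | rfl
  · exact hm
  · exact hx
  · exact hzero 0 (mem_univ _)
  · exact hzero 1 (mem_univ _)
  · exact hzero 2 (mem_univ _)

/-- The `2 × 2` minors of a pair of real vectors indexed by `Fin 5`. -/
def minor (f g : Fin 5 → ℝ) (i j : Fin 5) : ℝ := f i * g j - g i * f j

theorem minor_self (f g : Fin 5 → ℝ) (i : Fin 5) : minor f g i i = 0 := by
  unfold minor
  ring

theorem minor_swap (f g : Fin 5 → ℝ) (i j : Fin 5) : minor f g j i = -minor f g i j := by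
  unfold minor
  ring

theorem minor_mem_affineDependencies {p : Fin 5 → ℝ × ℝ} {f g : Fin 5 → ℝ}
    (hf : f ∈ affineDependencies p) (hg : g ∈ affineDependencies p) (m : Fin 5) :
    minor f g m ∈ affineDependencies p :=
  Submodule.sub_mem _ (Submodule.smul_mem _ (f m) hg) (Submodule.smul_mem _ (g m) hf)

/-- Five points in general position have a pair of affine dependencies all of whose minors are
nonzero, i.e. a Gale diagram in general position. -/
theorem exists_minor_ne_zero {p : Fin 5 → ℝ × ℝ}
    (hp : ∀ i j k, i ≠ j → i ≠ k → j ≠ k → ¬ Collinear ℝ ({p i, p j, p k} : Set (ℝ × ℝ))) :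
    ∃ f ∈ affineDependencies p, ∃ g ∈ affineDependencies p,
      ∀ i j, i ≠ j → minor f g i j ≠ 0 := by
  have hfin := one_lt_finrank_affineDependencies p
  have : Nontrivial (affineDependencies p) :=
    Module.nontrivial_of_finrank_pos (zero_lt_one.trans hfin)
  obtain ⟨⟨f, hf⟩, hf0⟩ := exists_ne (0 : affineDependencies p)
  obtain ⟨⟨g, hg⟩, hfg⟩ := exists_linearIndependent_pair_of_one_lt_finrank hfin hf0
  rw [LinearIndependent.pair_iff] at hfg
  have hvanish : ∀ i j, i ≠ j → minor f g i j = 0 → f i = 0 := by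
    intro i j hij h
    have hzero : minor f g i = 0 := eq_zero_of_mem_affineDependencies hp
      (minor_mem_affineDependencies hf hg i) hij (minor_self f g i) h
    refine (hfg (-g i) (f i) (Subtype.ext (funext fun y => ?_))).2
    have hy := congrFun hzero y
    simp only [minor, Pi.zero_apply] at hy
    simp
    linarith
  refine ⟨f, hf, g, hg, fun i j hij h => hf0 (Subtype.ext ?_)⟩
  exact eq_zero_of_mem_affineDependencies hp hf hij (hvanish i j hij h)
    (hvanish j i hij.symm (by rw [minor_swap, h, neg_zero]))

/-- The vectors `(f i, g i)` can be ordered by slope after a change of the first coordinate. -/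
theorem exists_perm_strictMono_div {f g : Fin 5 → ℝ} (hne : ∀ i j, i ≠ j → minor f g i j ≠ 0) :
    ∃ (c : ℝ) (σ : Equiv.Perm (Fin 5)), (∀ i, (f + c • g) i ≠ 0) ∧
      StrictMono fun i => g (σ i) / (f + c • g) (σ i) := by
  obtain ⟨c, hc⟩ := Infinite.exists_notMem_finset (univ.image fun i => -f i / g i)
  have hc0 : ∀ i, (f + c • g) i ≠ 0 := by
    intro i h
    simp only [Pi.add_apply, Pi.smul_apply, smul_eq_mul] at h
    by_cases hg : g i = 0
    · obtain ⟨j, hj⟩ := exists_ne i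
      refine hne i j hj.symm ?_
      rw [hg, mul_zero, add_zero] at h
      simp [minor, h, hg]
    · exact hc (mem_image.2 ⟨i, mem_univ i, by rw [div_eq_iff hg]; linarith⟩)
  refine ⟨c, Tuple.sort fun i => g i / (f + c • g) i, hc0,
    (Tuple.monotone_sort fun i => g i / (f + c • g) i).strictMono_of_injective ?_⟩
  refine Function.Injective.comp (fun i j hij => ?_) (Equiv.injective _)
  by_contra h
  refine hne i j h ?_
  rw [div_eq_div_iff (hc0 i) (hc0 j)] at hij
  simp only [Pi.add_apply, Pi.smul_apply, smul_eq_mul] at hij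
  unfold minor
  linarith

/-- `IsExceptional r m x` says that in the tournament `r` all edges between `m` and vertices other
than `x` are oriented alike with respect to `m`. -/
def IsExceptional (r : Fin 5 → Fin 5 → Bool) (m x : Fin 5) : Prop :=
  ∀ y, y ≠ m → y ≠ x → ∀ z, z ≠ m → z ≠ x → r m y = r m z

instance (r : Fin 5 → Fin 5 → Bool) (m x : Fin 5) : Decidable (IsExceptional r m x) := by
  unfold IsExceptional
  infer_instance

/-- The tournament obtained from the usual order on `Fin 5` by reversing all edges between vertices
of different signs. -/
def signedTournament (s : Fin 5 → Bool) (i j : Fin 5) : Bool :=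
  s i ^^ s j ^^ decide (i < j)

/-- In a signed tournament on five vertices without sources and sinks, the number of vertices that
are never exceptional determines the number of vertices having no exceptional vertex. -/
theorem two_mul_card_filter_not_isExceptional {s : Fin 5 → Bool}
    (hdeg : ∀ m, (∃ x, signedTournament s m x) ∧ ∃ x, signedTournament s x m) :
    2 * (univ.filter fun x => ∀ m, m ≠ x → ¬ IsExceptional (signedTournament s) m x).card =
      (univ.filter fun m => ∀ x, x ≠ m → ¬ IsExceptional (signedTournament s) m x).card + 5 := by
  decide +revert +kernel

/-- A point lies in the convex hull of three others among five points in general position exactly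
when the coefficients of the three other points in the affine dependency of these four points have
the same sign. -/
theorem mem_convexHull_image_compl_pair_iff {p : Fin 5 → ℝ × ℝ} (hinj : Function.Injective p)
    (hp : ∀ i j k, i ≠ j → i ≠ k → j ≠ k → ¬ Collinear ℝ ({p i, p j, p k} : Set (ℝ × ℝ)))
    {f g : Fin 5 → ℝ} (hf : f ∈ affineDependencies p) (hg : g ∈ affineDependencies p)
    (hne : ∀ i j, i ≠ j → minor f g i j ≠ 0) {m x : Fin 5} (hmx : m ≠ x) :
    p x ∈ convexHull ℝ ((({m, x}ᶜ : Finset (Fin 5)).image p : Finset (ℝ × ℝ)) : Set (ℝ × ℝ)) ↔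
      IsExceptional (fun i j => decide (0 < minor f g i j)) m x := by
  have hA := minor_mem_affineDependencies hf hg m
  have hAx := hne m x hmx
  have hsum : ∀ {M : Type} [AddCommGroup M] (F : Fin 5 → M),
      ∑ y, F y = F m + (F x + ∑ y ∈ {m, x}ᶜ, F y) := by
    intro M _ F
    rw [← sum_add_sum_compl {m, x} F, sum_pair hmx, add_assoc]
  obtain ⟨h0, h1⟩ := mem_affineDependencies.1 hA
  rw [hsum, minor_self, zero_add] at h0
  rw [hsum, minor_self, zero_smul, zero_add] at h1
  constructor
  · intro h
    obtain ⟨w, hw0, hw1, hwx⟩ := Finset.mem_convexHull'.1 h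
    rw [sum_image hinj.injOn] at hw1 hwx
    set d : Fin 5 → ℝ := fun y => if y = m then 0 else if y = x then -1 else w (p y) with hd
    have hdm : d m = 0 := by simp [hd]
    have hdx : d x = -1 := by simp [hd, hmx.symm]
    have hdy : ∀ y ∈ ({m, x}ᶜ : Finset (Fin 5)), d y = w (p y) := by
      intro y hy
      simp only [mem_compl, mem_insert, mem_singleton, not_or] at hy
      simp [hd, hy.1, hy.2]
    have hdmem : d ∈ affineDependencies p := by
      rw [mem_affineDependencies, hsum, hsum, hdm, hdx, sum_congr rfl hdy, hw1,
        sum_congr rfl fun y hy => by rw [hdy y hy], hwx]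
      simp
    have hzero := eq_zero_of_mem_affineDependencies hp
      (Submodule.add_mem _ (Submodule.smul_mem _ (minor f g m x) hdmem) hA) hmx
      (by simp [hdm, minor_self]) (by simp [hdx])
    have hprod : ∀ y, y ≠ m → y ≠ x → (0 < minor f g m y ↔ minor f g m x < 0) := by
      intro y hym hyx
      have hmem : y ∈ ({m, x}ᶜ : Finset (Fin 5)) := by simp [hym, hyx]
      have hy : minor f g m x * w (p y) + minor f g m y = 0 := by
        simpa [hdy y hmem] using congrFun hzero y
      have hwy := hw0 (p y) (mem_image_of_mem p hmem)
      have hAy := hne m y hym.symm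
      constructor
      · intro hpos
        by_contra hcon
        nlinarith [mul_nonneg (not_lt.1 hcon) hwy]
      · intro hneg
        refine lt_of_le_of_ne ?_ hAy.symm
        nlinarith
    intro y hym hyx z hzm hzx
    simp only [decide_eq_decide]
    rw [hprod y hym hyx, hprod z hzm hzx]
  · intro h
    have hcoef : ∀ y ∈ ({m, x}ᶜ : Finset (Fin 5)), 0 ≤ minor f g m y / -minor f g m x := by
      intro y hy
      simp only [mem_compl, mem_insert, mem_singleton, not_or] at hy
      have hsame : ∀ z ∈ ({m, x}ᶜ : Finset (Fin 5)),
          (0 < minor f g m y ↔ 0 < minor f g m z) := by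
        intro z hz
        simp only [mem_compl, mem_insert, mem_singleton, not_or] at hz
        simpa only [decide_eq_decide] using h y hy.1 hy.2 z hz.1 hz.2
      have hneg : -minor f g m x = ∑ z ∈ {m, x}ᶜ, minor f g m z := by linarith
      rw [hneg]
      by_cases hpos : 0 < minor f g m y
      · exact div_nonneg hpos.le (sum_nonneg fun z hz => ((hsame z hz).1 hpos).le)
      · exact div_nonneg_of_nonpos (not_lt.1 hpos)
          (sum_nonpos fun z hz => not_lt.1 (mt (hsame z hz).2 hpos))
    have hx : p x = ∑ y ∈ {m, x}ᶜ, (minor f g m y / -minor f g m x) • p y := by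
      have hrest : ∑ y ∈ {m, x}ᶜ, minor f g m y • p y = -(minor f g m x • p x) := by
        rw [eq_neg_iff_add_eq_zero, add_comm, h1]
      simp_rw [div_eq_inv_mul, mul_smul]
      rw [← smul_sum, hrest, ← neg_smul, smul_smul, inv_mul_cancel₀ (neg_ne_zero.2 hAx), one_smul]
    rw [hx]
    refine (convex_convexHull ℝ _).sum_mem hcoef ?_ fun y hy =>
      subset_convexHull ℝ _ (mem_coe.2 (mem_image_of_mem p hy))
    rw [← sum_div, div_eq_one_iff_eq (neg_ne_zero.2 hAx)]
    linarith

theorem minor_eq_mul_sub_div {f g : Fin 5 → ℝ} (hf : ∀ i, f i ≠ 0) (i j : Fin 5) :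
    minor f g i j = f i * f j * (g j / f j - g i / f i) := by
  have hi := hf i
  have hj := hf j
  unfold minor
  field_simp

theorem minor_ne_zero_of_strictMono_div {f g : Fin 5 → ℝ} (hf : ∀ i, f i ≠ 0)
    (hmono : StrictMono fun i => g i / f i) {i j : Fin 5} (hij : i ≠ j) : minor f g i j ≠ 0 := by
  rw [minor_eq_mul_sub_div hf]
  exact mul_ne_zero (mul_ne_zero (hf i) (hf j)) (sub_ne_zero.2 (hmono.injective.ne hij.symm))

/-- The signs of the minors of vectors ordered by slope form a signed tournament. -/
theorem decide_minor_pos_eq_signedTournament {f g : Fin 5 → ℝ} (hf : ∀ i, f i ≠ 0)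
    (hmono : StrictMono fun i => g i / f i) :
    (fun i j => decide (0 < minor f g i j)) = signedTournament fun i => decide (0 < f i) := by
  funext i j
  have hsigns : 0 < f i * f j ↔ (0 < f i ↔ 0 < f j) := by
    rcases (hf i).lt_or_gt with hi | hi <;> rcases (hf j).lt_or_gt with hj | hj
    · simp [hi.not_gt, hj.not_gt, mul_pos_of_neg_of_neg hi hj]
    · simp [hi.not_gt, hj]
    · simp [hi, hj.not_gt]
    · simp [hi, hj]
  have hne := mul_ne_zero (hf i) (hf j)
  rw [minor_eq_mul_sub_div hf, Bool.eq_iff_iff, decide_eq_true_eq]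
  unfold signedTournament
  rcases lt_trichotomy i j with hij | rfl | hij
  · rw [mul_pos_iff_of_pos_right (sub_pos.2 (hmono hij)), hsigns]
    by_cases hi : 0 < f i <;> by_cases hj : 0 < f j <;> simp [hij, hi, hj]
  · simp
  · rw [← neg_mul_neg, mul_pos_iff_of_pos_right (neg_pos.2 (sub_neg.2 (hmono hij))), neg_pos,
      ← not_le, hne.symm.le_iff_lt, hsigns]
    by_cases hi : 0 < f i <;> by_cases hj : 0 < f j <;> simp [hij.not_gt, hi, hj]

/-- Five points in general position can be labelled so that they have a Gale diagram in general
position whose vectors are ordered by slope. -/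
theorem exists_strictMono_div_affineDependencies {S : Finset (ℝ × ℝ)} (hgp : GenPos S)
    (hcard : S.card = 5) :
    ∃ p : Fin 5 → ℝ × ℝ, Function.Injective p ∧ univ.image p = S ∧
      ∃ f ∈ affineDependencies p, ∃ g ∈ affineDependencies p,
        (∀ i, f i ≠ 0) ∧ StrictMono fun i => g i / f i := by
  obtain ⟨p, hinj, rfl⟩ : ∃ p : Fin 5 → ℝ × ℝ, Function.Injective p ∧ univ.image p = S := by
    refine ⟨fun i => (S.equivFinOfCardEq hcard).symm i,
      Subtype.val_injective.comp (Equiv.injective _), ?_⟩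
    ext y
    simp only [mem_image, mem_univ, true_and]
    exact ⟨fun ⟨i, hi⟩ => hi ▸ Subtype.prop _,
      fun hy => ⟨S.equivFinOfCardEq hcard ⟨y, hy⟩, by simp⟩⟩
  obtain ⟨f, hf, g, hg, hne⟩ := exists_minor_ne_zero (not_collinear_of_genPos hgp hinj)
  obtain ⟨c, σ, hc, hmono⟩ := exists_perm_strictMono_div hne
  refine ⟨p ∘ σ, hinj.comp σ.injective, ?_, (f + c • g) ∘ σ,
    comp_mem_affineDependencies σ (Submodule.add_mem _ hf (Submodule.smul_mem _ c hg)), g ∘ σ,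
    comp_mem_affineDependencies σ hg, fun i => hc (σ i), hmono⟩
  rw [← image_image, image_univ_equiv]

/-- The relation between the numbers of never exceptional vertices and of vertices having no
exceptional vertex for the signs of a Gale diagram. -/
theorem two_mul_card_filter_not_isExceptional_minor {p : Fin 5 → ℝ × ℝ} {f g : Fin 5 → ℝ}
    (hfmem : f ∈ affineDependencies p) (hg : g ∈ affineDependencies p) (hf : ∀ i, f i ≠ 0)
    (hmono : StrictMono fun i => g i / f i) :
    2 * (univ.filter fun x => ∀ m, m ≠ x →
        ¬ IsExceptional (fun i j => decide (0 < minor f g i j)) m x).card =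
      (univ.filter fun m => ∀ x, x ≠ m →
        ¬ IsExceptional (fun i j => decide (0 < minor f g i j)) m x).card + 5 := by
  have hr := decide_minor_pos_eq_signedTournament hf hmono
  have hdeg : ∀ m, (∃ x, decide (0 < minor f g m x)) ∧ ∃ x, decide (0 < minor f g x m) := by
    intro m
    have hsum := (mem_affineDependencies.1 (minor_mem_affineDependencies hfmem hg m)).1
    obtain ⟨x, hx⟩ := exists_ne m
    have hex : ∃ y ∈ univ, minor f g m y ≠ 0 :=
      ⟨x, mem_univ x, minor_ne_zero_of_strictMono_div hf hmono hx.symm⟩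
    obtain ⟨y, -, hy⟩ := exists_pos_of_sum_zero_of_exists_nonzero _ hsum hex
    obtain ⟨z, -, hz⟩ := exists_pos_of_sum_zero_of_exists_nonzero (fun y => -minor f g m y)
      (by rw [sum_neg_distrib, hsum, neg_zero]) (by simpa using hex)
    exact ⟨⟨y, by simpa using hy⟩, z, by simpa [minor_swap f g m z] using hz⟩
  rw [hr]
  refine two_mul_card_filter_not_isExceptional fun m => ?_
  rw [← hr]
  exact hdeg m

/-- Four of five points are in convex position exactly when none of them lies in the convex hull
of the other three. -/
theorem convexPos_image_erase_iff {p : Fin 5 → ℝ × ℝ} (hinj : Function.Injective p) (m : Fin 5) :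
    ConvexPos ((univ.erase m).image p) ↔ ∀ x, x ≠ m →
      p x ∉ convexHull ℝ ((({m, x}ᶜ : Finset (Fin 5)).image p : Finset (ℝ × ℝ)) :
        Set (ℝ × ℝ)) := by
  have herase : ∀ x, ((univ.erase m).image p).erase (p x) = ({m, x}ᶜ : Finset (Fin 5)).image p := by
    intro x
    rw [← image_erase hinj]
    congr 1
    ext y
    simp [and_comm]
  have hiff : ∀ x, x ≠ m → (p x ∈ Set.extremePoints ℝ
      (convexHull ℝ (((univ.erase m).image p : Finset (ℝ × ℝ)) : Set (ℝ × ℝ))) ↔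
      p x ∉ convexHull ℝ ((({m, x}ᶜ : Finset (Fin 5)).image p : Finset (ℝ × ℝ)) :
        Set (ℝ × ℝ))) := by
    intro x hx
    rw [mem_extremePoints_convexHull_iff (mem_image_of_mem p (by simp [hx])), herase]
  unfold ConvexPos
  simp only [forall_mem_image, mem_erase, mem_univ, and_true]
  exact forall₂_congr hiff

/-- By Carathéodory's theorem, one of five points is extreme exactly when it is not in the convex
hull of any three other points. -/
theorem mem_extremePoints_convexHull_image_iff {p : Fin 5 → ℝ × ℝ} (hinj : Function.Injective p)
    (x : Fin 5) :
    p x ∈ Set.extremePoints ℝ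
        (convexHull ℝ ((univ.image p : Finset (ℝ × ℝ)) : Set (ℝ × ℝ))) ↔
      ∀ m, m ≠ x → p x ∉
        convexHull ℝ ((({m, x}ᶜ : Finset (Fin 5)).image p : Finset (ℝ × ℝ)) : Set (ℝ × ℝ)) := by
  rw [mem_extremePoints_convexHull_iff (mem_image_of_mem p (mem_univ x)), ← image_erase hinj,
    ← not_iff_not]
  push Not
  refine ⟨fun h => ?_, fun ⟨m, _, h⟩ => convexHull_mono (coe_subset.2
    (image_subset_image fun y => by simp +contextual)) h⟩
  rw [convexHull_eq_union] at h
  simp only [Set.mem_iUnion] at h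
  obtain ⟨t, ht, hind, hxt⟩ := h
  have hcard : t.card ≤ 3 := by
    simpa [Module.finrank_prod] using hind.card_le_finrank_succ.trans
      (Nat.succ_le_succ (Submodule.finrank_le _))
  obtain ⟨q, hq, hqt⟩ := exists_mem_notMem_of_card_lt_card
    (s := t) (t := (univ.erase x).image p) (by
      rw [card_image_of_injective _ hinj, card_erase_of_mem (mem_univ x), card_univ,
        Fintype.card_fin]
      omega)
  obtain ⟨m, hm, rfl⟩ := mem_image.1 hq
  refine ⟨m, ne_of_mem_erase hm, convexHull_mono (fun y hy => ?_) hxt⟩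
  obtain ⟨z, hz, rfl⟩ := mem_image.1 (mem_coe.1 (ht hy))
  refine mem_coe.2 (mem_image_of_mem p ?_)
  have hzm : z ≠ m := fun h => hqt (h ▸ hy)
  simp [hzm, ne_of_mem_erase hz]

/-- The number of convex quadrilaterals among five points, counted by the omitted point. -/
theorem convexPosCount_image_four {p : Fin 5 → ℝ × ℝ} (hinj : Function.Injective p)
    {q : Fin 5 → Prop} [DecidablePred q] (hq : ∀ m, ConvexPos ((univ.erase m).image p) ↔ q m) :
    convexPosCount (univ.image p) 4 = (univ.filter q).card := by
  classical
  unfold convexPosCount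
  symm
  refine card_bij (fun m _ => (univ.erase m).image p) (fun m hm => ?_) (fun m _ n _ h => ?_)
    fun T hT => ?_
  · refine mem_filter.2 ⟨mem_powersetCard.2 ⟨image_subset_image (subset_univ _), ?_⟩,
      (hq m).2 (mem_filter.1 hm).2⟩
    rw [card_image_of_injective _ hinj, card_erase_of_mem (mem_univ m), card_univ,
      Fintype.card_fin]
  · exact erase_injOn univ (mem_univ m) (mem_univ n) (image_injective hinj h)
  · obtain ⟨hT, hconv⟩ := mem_filter.1 hT
    obtain ⟨hsub, hcard⟩ := mem_powersetCard.1 hT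
    obtain ⟨U, -, rfl⟩ := subset_image_iff.1 hsub
    rw [card_image_of_injective _ hinj] at hcard
    obtain ⟨m, hm⟩ := card_eq_one.1 (show (Uᶜ).card = 1 by simp [card_compl, hcard])
    have hU : univ.erase m = U := by
      rw [← compl_compl U, hm, compl_singleton]
    exact ⟨m, mem_filter.2 ⟨mem_univ m, (hq m).1 (by rwa [hU])⟩, by rw [hU]⟩

/-- For a set `S` of 5 points in general position, the number of 4-element subsets of
`S` in convex position is 5, 3 or 1 according to whether the convex hull of `S` has
5, 4 or 3 extreme points. -/
theorem convex_quads_in_five_points (S : Finset (ℝ × ℝ)) (hgp : GenPos S)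
    (hcard : S.card = 5) :
    ((Set.extremePoints ℝ (convexHull ℝ (S : Set (ℝ × ℝ)))).ncard = 5 →
        convexPosCount S 4 = 5) ∧
    ((Set.extremePoints ℝ (convexHull ℝ (S : Set (ℝ × ℝ)))).ncard = 4 →
        convexPosCount S 4 = 3) ∧
    ((Set.extremePoints ℝ (convexHull ℝ (S : Set (ℝ × ℝ)))).ncard = 3 →
        convexPosCount S 4 = 1) := by
  obtain ⟨p, hinj, rfl, f, hfmem, g, hg, hf, hmono⟩ :=
    exists_strictMono_div_affineDependencies hgp hcard
  have hmem := fun {m x : Fin 5} (hmx : m ≠ x) =>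
    mem_convexHull_image_compl_pair_iff hinj (not_collinear_of_genPos hgp hinj) hfmem hg
      (fun _ _ => minor_ne_zero_of_strictMono_div hf hmono) hmx
  have hext : Set.extremePoints ℝ
      (convexHull ℝ ((univ.image p : Finset (ℝ × ℝ)) : Set (ℝ × ℝ))) =
      ((univ.filter fun x => ∀ m, m ≠ x →
        ¬ IsExceptional (fun i j => decide (0 < minor f g i j)) m x).image p :
          Finset (ℝ × ℝ)) := by
    have hiff : ∀ x, p x ∈ Set.extremePoints ℝ
        (convexHull ℝ ((univ.image p : Finset (ℝ × ℝ)) : Set (ℝ × ℝ))) ↔ ∀ m, m ≠ x →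
        ¬ IsExceptional (fun i j => decide (0 < minor f g i j)) m x := fun x =>
      (mem_extremePoints_convexHull_image_iff hinj x).trans
        (forall₂_congr fun m hm => not_congr (hmem hm))
    ext y
    constructor
    · intro hy
      obtain ⟨x, -, rfl⟩ := mem_image.1 (mem_coe.1 (extremePoints_convexHull_subset hy))
      exact mem_coe.2 (mem_image_of_mem p (mem_filter.2 ⟨mem_univ x, (hiff x).1 hy⟩))
    · intro hy
      obtain ⟨x, hx, rfl⟩ := mem_image.1 (mem_coe.1 hy)
      exact (hiff x).2 (mem_filter.1 hx).2
  have hconv : ∀ m, ConvexPos ((univ.erase m).image p) ↔ ∀ x, x ≠ m →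
      ¬ IsExceptional (fun i j => decide (0 < minor f g i j)) m x := fun m =>
    (convexPos_image_erase_iff hinj m).trans
      (forall₂_congr fun x hx => not_congr (hmem hx.symm))
  rw [hext, Set.ncard_coe_finset, card_image_of_injective _ hinj, 
    convexPosCount_image_four hinj hconv]
  have hcount := two_mul_card_filter_not_isExceptional_minor hfmem hg hf hmono
  omega
end
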